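/- arXiv:1402.3231 — 6 statements merged into one kernel-verified Lean document; each statement's English description precedes it below -/
import Mathlib

section
/- Let ε > 0 and let F : (−ε,ε) → ℂ be a C^∞ function satisfying: (i) F is real-analytic on (−ε,0) and on (0,ε); (ii) there are a finite set Λ ⊂ ℂ × ℤ_{≥0} and real-analytic functions f_{λ,j} : (−ε,ε) → ℂ for (λ,j) ∈ Λ such that F(x) = Σ_{(λ,j)∈Λ} x^λ (log x)^j f_{λ,j}(x) for all x ∈ (0,ε); (iii) there are a finite set Λ' ⊂ ℂ × ℤ_{≥0} and real-analytic functions g_{λ,j} : (−ε,ε) → ℂ for (λ,j) ∈ Λ' such that F(x) = Σ_{(λ,j)∈Λ'} (−x)^λ (log(−x))^j g_{λ,j}(x) for all x ∈ (−ε,0). Then F is real-analytic on the whole interval (−ε,ε). -/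
set_option autoImplicit false

open Set
open Filter Topology Asymptotics Polynomial

theorem Complex.eq_of_forall_exp_mul_ofReal_eq {μ ν : ℂ}
    (h : ∀ t : ℝ, Complex.exp (μ * t) = Complex.exp (ν * t)) : μ = ν := by
  have key (z : ℂ) : HasDerivAt (fun t : ℝ ↦ Complex.exp (z * t)) z 0 := by
    simpa using ((Complex.ofRealCLM.hasDerivAt (x := (0 : ℝ))).const_mul z).cexp
  exact (key μ).unique (by simpa only [h] using key ν)

theorem Polynomial.eq_zero_of_forall_taylor_eq_self_of_tendsto_zero {q : ℂ[X]}
    (hq : ∀ s : ℝ, taylor (s : ℂ) q = q)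
    (h : Tendsto (fun t : ℝ ↦ q.eval (t : ℂ)) atTop (𝓝 0)) : q = 0 := by
  have hconst (t : ℝ) : q.eval (t : ℂ) = q.eval 0 := by
    conv_rhs => rw [← hq t, taylor_eval, zero_add]
  have h0 : q.eval 0 = 0 :=
    tendsto_nhds_unique (tendsto_const_nhds.congr fun t ↦ (hconst t).symm) h
  refine eq_zero_of_infinite_isRoot q
    ((Set.infinite_range_of_injective Complex.ofReal_injective).mono ?_)
  rintro _ ⟨t, rfl⟩
  simp [IsRoot, hconst t, h0]

/-- An exponential polynomial with frequencies in the closed right half-plane that tends to zero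
at infinity is trivial. -/
theorem Polynomial.eq_zero_of_tendsto_sum_exp_mul_eval (S : Finset ℂ)
    (hS : ∀ ν ∈ S, 0 ≤ ν.re) (q : ℂ → ℂ[X])
    (h : Tendsto (fun t : ℝ ↦ ∑ ν ∈ S, Complex.exp (ν * t) * (q ν).eval (t : ℂ)) atTop (𝓝 0)) :
    ∀ ν ∈ S, q ν = 0 := by
  induction S using Finset.induction_on generalizing q with
  | empty => simp
  | insert ν₀ S hν₀ ih =>
  have ih' := ih fun ν hν ↦ hS ν (Finset.mem_insert_of_mem hν)
  obtain ⟨d, hd⟩ : ∃ d : ℕ, (q ν₀).degree < d :=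
    ⟨(q ν₀).natDegree + 1, degree_le_natDegree.trans_lt (by exact_mod_cast Nat.lt_succ_self _)⟩
  induction d generalizing q with
  | zero =>
    have h0 : q ν₀ = 0 := by simpa using hd
    have := ih' q (by simpa [Finset.sum_insert hν₀, h0] using h)
    simpa [h0] using this
  | succ d ihd =>
    set q' : ℝ → ℂ → ℂ[X] := fun s ν ↦
      C (Complex.exp (ν * s)) * taylor (s : ℂ) (q ν) - C (Complex.exp (ν₀ * s)) * q ν with hq'
    have hq'0 (s : ℝ) : ∀ ν ∈ insert ν₀ S, q' s ν = 0 := by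
      refine ihd (q' s) ?_ ?_
      · have h1 := h.comp (tendsto_atTop_add_const_right atTop s tendsto_id)
        have h2 := h1.sub (h.const_mul (Complex.exp (ν₀ * s)))
        rw [mul_zero, sub_zero] at h2
        refine h2.congr fun t ↦ ?_
        simp only [hq', Function.comp, id, Finset.mul_sum, ← Finset.sum_sub_distrib, eval_sub,
          eval_mul, eval_C, taylor_eval, Complex.ofReal_add, mul_add, Complex.exp_add]
        exact Finset.sum_congr rfl fun ν _ ↦ by ring
      · by_cases h0 : q ν₀ = 0
        · simp [hq', h0]
        have h1 : q' s ν₀ = C (Complex.exp (ν₀ * s)) * (taylor (s : ℂ) (q ν₀) - q ν₀) := by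
          simp only [hq', mul_sub]
        have h2 : (taylor (s : ℂ) (q ν₀) - q ν₀).degree < (q ν₀).degree :=
          degree_sub_lt_right (degree_taylor _ _) h0 (leadingCoeff_taylor _ _)
        rw [h1, degree_C_mul (Complex.exp_ne_zero _)]
        exact h2.trans_le <| degree_le_of_natDegree_le <| Nat.lt_succ_iff.1 <|
          (natDegree_lt_iff_degree_lt h0).2 hd
    have hSzero : ∀ ν ∈ S, q ν = 0 := by
      intro ν hν
      by_contra hne
      refine hν₀ ((Complex.eq_of_forall_exp_mul_ofReal_eq fun s ↦ ?_ : ν = ν₀) ▸ hν)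
      have := congrArg (fun p ↦ p.coeff (q ν).natDegree) (hq'0 s ν (Finset.mem_insert_of_mem hν))
      simp only [hq', coeff_sub, coeff_C_mul, coeff_taylor_natDegree, coeff_natDegree, coeff_zero,
        ← sub_mul] at this
      exact sub_eq_zero.1 ((mul_eq_zero.1 this).resolve_right (leadingCoeff_ne_zero.2 hne))
    have hlim : Tendsto (fun t : ℝ ↦ Complex.exp (ν₀ * t) * (q ν₀).eval (t : ℂ)) atTop (𝓝 0) := by
      refine h.congr fun t ↦ ?_
      rw [Finset.sum_insert hν₀, Finset.sum_eq_zero fun ν hν ↦ by simp [hSzero ν hν], add_zero]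
    have hν₀zero : q ν₀ = 0 := by
      refine eq_zero_of_forall_taylor_eq_self_of_tendsto_zero (fun s ↦ ?_) ?_
      · have := hq'0 s ν₀ (Finset.mem_insert_self _ _)
        simp only [hq', ← mul_sub, mul_eq_zero, C_eq_zero, Complex.exp_ne_zero, false_or] at this
        exact sub_eq_zero.1 this
      · refine squeeze_zero_norm' ?_ (tendsto_zero_iff_norm_tendsto_zero.1 hlim)
        filter_upwards [eventually_ge_atTop 0] with t ht
        rw [norm_mul, Complex.norm_exp]
        refine le_mul_of_one_le_left (norm_nonneg _) (Real.one_le_exp ?_)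
        simpa using mul_nonneg (hS ν₀ (Finset.mem_insert_self _ _)) ht
    simpa [hν₀zero] using hSzero

/-- The function `x ↦ x ^ λ * (log x) ^ j` attached to the exponent `(λ, j)`. -/
noncomputable def powLog (k : ℂ × ℕ) (x : ℝ) : ℂ :=
  (x : ℂ) ^ k.1 * (Real.log x : ℂ) ^ k.2

theorem isLittleO_powLog_rpow {k : ℂ × ℕ} {M : ℝ} (hM : M < k.1.re) :
    powLog k =o[𝓝[>] 0] fun x : ℝ ↦ x ^ M := by
  have h1 := (isBigO_refl (fun x : ℝ ↦ x ^ k.1.re) (𝓝[>] 0)).mul_isLittleO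
    (isLittleO_abs_log_rpow_rpow_nhdsGT_zero k.2 (sub_neg.2 hM))
  refine IsLittleO.of_norm_left (h1.congr' ?_ ?_)
  · filter_upwards [self_mem_nhdsWithin] with x hx
    rw [powLog, norm_mul, Complex.norm_cpow_eq_rpow_re_of_pos hx, norm_pow, Complex.norm_real,
      Real.norm_eq_abs, Real.rpow_natCast]
  · filter_upwards [self_mem_nhdsWithin] with x hx
    rw [← Real.rpow_add hx, add_sub_cancel]

theorem powLog_exp_neg (k : ℂ × ℕ) (t : ℝ) :
    powLog k (Real.exp (-t)) = Complex.exp (-k.1 * t) * (-t : ℂ) ^ k.2 := by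
  rw [powLog, Real.log_exp, Complex.cpow_def_of_ne_zero (by exact_mod_cast (Real.exp_pos _).ne'),
    ← Complex.ofReal_log (Real.exp_pos _).le, Real.log_exp]
  push_cast
  ring_nf

/-- The coefficients of an asymptotic expansion in terms of `x ^ λ * (log x) ^ j` are unique. -/
theorem sum_filter_eq_zero_of_sum_powLog_isLittleO {κ : Type*} (T : Finset κ) (e : κ → ℂ × ℕ)
    (c : κ → ℂ) {M : ℝ}
    (h : (fun x : ℝ ↦ ∑ z ∈ T, c z * powLog (e z) x) =o[𝓝[>] 0] fun x : ℝ ↦ x ^ M)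
    (k : ℂ × ℕ) (hk : k.1.re ≤ M) : ∑ z ∈ T with e z = k, c z = 0 := by
  set T' := T.filter fun z ↦ (e z).1.re ≤ M with hT'
  have hlow : (fun x : ℝ ↦ ∑ z ∈ T', c z * powLog (e z) x) =o[𝓝[>] 0] fun x : ℝ ↦ x ^ M := by
    have hhigh : (fun x : ℝ ↦ ∑ z ∈ T with ¬ (e z).1.re ≤ M, c z * powLog (e z) x)
        =o[𝓝[>] 0] fun x : ℝ ↦ x ^ M :=
      IsLittleO.fun_sum fun z hz ↦
        (isLittleO_powLog_rpow (not_le.1 (Finset.mem_filter.1 hz).2)).const_mul_left _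
    refine (h.sub hhigh).congr_left fun x ↦ ?_
    rw [← Finset.sum_filter_add_sum_filter_not T (fun z ↦ (e z).1.re ≤ M), add_sub_cancel_right]
  set S : Finset ℂ := T'.image fun z ↦ M - (e z).1 with hSdef
  set q : ℂ → ℂ[X] := fun ν ↦
    ∑ z ∈ T' with M - (e z).1 = ν, C (c z * (-1) ^ (e z).2) * X ^ (e z).2 with hq
  have hqzero : ∀ ν ∈ S, q ν = 0 := by
    refine eq_zero_of_tendsto_sum_exp_mul_eval S ?_ q ?_
    · simp only [hSdef, Finset.mem_image, hT', Finset.mem_filter]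
      rintro _ ⟨z, ⟨-, hz⟩, rfl⟩
      simpa using hz
    · have htend : Tendsto (fun t : ℝ ↦ Real.exp (-t)) atTop (𝓝[>] 0) :=
        tendsto_nhdsWithin_iff.2 ⟨Real.tendsto_exp_neg_atTop_nhds_zero,
          Eventually.of_forall fun t ↦ Real.exp_pos _⟩
      have h1 := (hlow.comp_tendsto htend).trans_isBigO
        (k := fun t ↦ ((Real.exp (-t) ^ M : ℝ) : ℂ)) (isBigO_of_le _ fun t ↦ by simp)
      have h2 := (isBigO_refl (fun t : ℝ ↦ Complex.exp (M * t)) atTop).mul_isLittleO h1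
      rw [← isLittleO_one_iff (F := ℝ)]
      refine IsLittleO.congr' (h2.trans_isBigO (k := fun _ ↦ (1 : ℝ)) ?_) ?_ .rfl
      · refine IsBigO.of_bound 1 (Eventually.of_forall fun t ↦ ?_)
        simp [Complex.norm_exp, ← Real.exp_mul, ← Real.exp_add, mul_comm]
      · refine Eventually.of_forall fun t ↦ ?_
        simp only [Function.comp, powLog_exp_neg]
        rw [Finset.mul_sum, ← Finset.sum_fiberwise_of_maps_to (s := T') (t := S)
          (g := fun z ↦ M - (e z).1) fun z hz ↦ Finset.mem_image_of_mem _ hz]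
        refine Finset.sum_congr rfl fun ν _ ↦ ?_
        rw [hq, eval_finsetSum, Finset.mul_sum]
        refine Finset.sum_congr rfl fun z hz ↦ ?_
        rw [← (Finset.mem_filter.1 hz).2, sub_mul, sub_eq_add_neg, Complex.exp_add, neg_pow]
        simp
        ring
  by_cases hkS : (M : ℂ) - k.1 ∈ S
  · have h3 := congrArg (fun p ↦ p.coeff k.2) (hqzero _ hkS)
    simp only [hq, finsetSum_coeff, coeff_C_mul, coeff_X_pow, coeff_zero, hT', sub_right_inj,
      mul_ite, mul_one, mul_zero, ← Finset.sum_filter, Finset.filter_filter] at h3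
    have h4 : ∑ z ∈ T with e z = k, c z * (-1) ^ (e z).2 = 0 := by
      rw [← h3]
      refine Finset.sum_congr (Finset.filter_congr fun z _ ↦ ?_) fun _ _ ↦ rfl
      refine ⟨?_, fun h ↦ Prod.ext h.1.2 h.2.symm⟩
      rintro rfl
      exact ⟨⟨hk, rfl⟩, rfl⟩
    rw [Finset.sum_congr rfl fun z hz ↦ by rw [(Finset.mem_filter.1 hz).2],
      ← Finset.sum_mul] at h4
    exact (mul_eq_zero.1 h4).resolve_right (by simp)
  · rw [Finset.filter_eq_empty_iff.2, Finset.sum_empty]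
    rintro z hz rfl
    exact hkS (Finset.mem_image_of_mem _ (Finset.mem_filter.2 ⟨hz, hk⟩))

/-- The exponent of `x ^ λ * (log x) ^ j * x ^ n`. -/
def shiftExponent (k : ℂ × ℕ) (n : ℕ) : ℂ × ℕ := (k.1 + n, k.2)

theorem shiftExponent_injective (k : ℂ × ℕ) : Function.Injective (shiftExponent k) := fun m n h ↦ by
  simpa [shiftExponent] using h

theorem powLog_shiftExponent (k : ℂ × ℕ) (n : ℕ) {x : ℝ} (hx : 0 < x) :
    powLog (shiftExponent k n) x = powLog k x * (x : ℂ) ^ n := by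
  simp only [powLog, shiftExponent]
  rw [Complex.cpow_add _ _ (by exact_mod_cast hx.ne'), Complex.cpow_natCast]
  ring

theorem Function.Injective.extend_comp_mul {α β R : Type*} [MulZeroClass R] {g : α → β}
    (hg : Function.Injective g) (P : β → R) (b : α → R) (k : β) :
    Function.extend g (fun n ↦ P (g n) * b n) 0 k = P k * Function.extend g b 0 k := by
  by_cases hk : ∃ n, g n = k
  · obtain ⟨n, rfl⟩ := hk
    simp only [hg.extend_apply]
  · simp [Function.extend_apply' _ _ _ hk]

/-- If `∑ i, x ^ λ i * (log x) ^ j i * φ i x` vanishes near `0⁺` and each `φ i` has an asymptotic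
power series, then all coefficients of the resulting formal expansion vanish. -/
theorem sum_extend_shiftExponent_eq_zero {ι : Type*} [Fintype ι] (e : ι → ℂ × ℕ)
    (φ : ι → ℝ → ℂ) (b : ι → ℕ → ℂ)
    (hφ : ∀ i N, (fun x ↦ φ i x - ∑ n ∈ Finset.range N, x ^ n • b i n) =O[𝓝[>] 0]
      fun x : ℝ ↦ x ^ N)
    (h : ∀ᶠ x in 𝓝[>] 0, ∑ i, powLog (e i) x * φ i x = 0) (k : ℂ × ℕ) :
    ∑ i, Function.extend (shiftExponent (e i)) (b i) 0 k = 0 := by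
  obtain ⟨N, hN⟩ : ∃ N : ℕ, ∀ i, k.1.re + 1 - (e i).1.re < N :=
    (eventually_all.2 fun i ↦ tendsto_natCast_atTop_atTop.eventually_gt_atTop
      (k.1.re + 1 - (e i).1.re)).exists
  have hrem (i : ι) : (fun x ↦ powLog (e i) x * (φ i x - ∑ n ∈ Finset.range N, x ^ n • b i n))
      =o[𝓝[>] 0] fun x : ℝ ↦ x ^ k.1.re := by
    refine ((isLittleO_powLog_rpow (sub_one_lt (e i).1.re)).mul_isBigO (hφ i N)).trans_isBigO ?_
    refine IsBigO.of_bound 1 ?_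
    filter_upwards [Ioo_mem_nhdsGT one_pos] with x hx
    rw [one_mul, ← Real.rpow_natCast, ← Real.rpow_add hx.1]
    simp only [Real.norm_eq_abs, abs_of_pos (Real.rpow_pos_of_pos hx.1 _)]
    exact Real.rpow_le_rpow_of_exponent_ge hx.1 hx.2.le (by linarith [hN i])
  have hsum := sum_filter_eq_zero_of_sum_powLog_isLittleO
    (Finset.univ ×ˢ Finset.range N) (fun z : ι × ℕ ↦ shiftExponent (e z.1) z.2)
    (fun z ↦ b z.1 z.2) (M := k.1.re) ?_ k le_rfl
  · rw [← hsum, Finset.sum_filter, Finset.sum_product]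
    refine Finset.sum_congr rfl fun i _ ↦ ?_
    by_cases hk : ∃ m, shiftExponent (e i) m = k
    · obtain ⟨m, rfl⟩ := hk
      have hm : m < N := by
        have := hN i
        simp only [shiftExponent, Complex.add_re, Complex.natCast_re] at this
        exact_mod_cast (by linarith : (m : ℝ) < N)
      simp [(shiftExponent_injective (e i)).extend_apply, (shiftExponent_injective (e i)).eq_iff,
        hm]
    · rw [Function.extend_apply' _ _ _ hk, Finset.sum_eq_zero fun n _ ↦ if_neg fun hn ↦ hk ⟨n, hn⟩]
      rfl
  · refine (IsLittleO.fun_sum fun i (_ : i ∈ Finset.univ) ↦ hrem i).neg_left.congr' ?_ .rfl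
    filter_upwards [h, self_mem_nhdsWithin] with x hx hx0
    simp only [mul_sub, Finset.sum_sub_distrib, hx, zero_sub, neg_neg, Finset.mul_sum]
    rw [Finset.sum_product]
    refine Finset.sum_congr rfl fun i _ ↦ Finset.sum_congr rfl fun n _ ↦ ?_
    rw [powLog_shiftExponent _ _ hx0, Complex.real_smul]
    push_cast
    ring

theorem AnalyticAt.exists_hasSum_and_isBigO {f : ℝ → ℂ} (hf : AnalyticAt ℝ f 0) :
    ∃ b : ℕ → ℂ, (∀ᶠ x in 𝓝 0, HasSum (fun n ↦ x ^ n • b n) (f x)) ∧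
      ∀ N, (fun x ↦ f x - ∑ n ∈ Finset.range N, x ^ n • b n) =O[𝓝 0] fun x : ℝ ↦ x ^ N := by
  obtain ⟨p, hp⟩ := hf
  refine ⟨p.coeff, by simpa using hasFPowerSeriesAt_iff.1 hp, fun N ↦ ?_⟩
  refine IsBigO.of_norm_right ?_
  simpa [FormalMultilinearSeries.partialSum] using hp.isBigO_sub_partialSum_pow N

/-- A function with a one-sided asymptotic power series and an expansion in terms of
`x ^ λ * (log x) ^ j` with analytic coefficients is the sum of its asymptotic power series. -/
theorem eventually_hasSum_of_eventually_eq_sum_powLog {H : ℝ → ℂ} {a : ℕ → ℂ}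
    (hH : ∀ N, (fun x ↦ H x - ∑ n ∈ Finset.range N, x ^ n • a n) =O[𝓝[>] 0] fun x : ℝ ↦ x ^ N)
    (Λ : Finset (ℂ × ℕ)) {f : ℂ × ℕ → ℝ → ℂ} (hf : ∀ p ∈ Λ, AnalyticAt ℝ (f p) 0)
    (hrep : ∀ᶠ x in 𝓝[>] 0, H x = ∑ p ∈ Λ, powLog p x * f p x) :
    ∀ᶠ x in 𝓝[>] 0, HasSum (fun n ↦ x ^ n • a n) (H x) := by
  choose! b hbsum hbO using fun p hp ↦ (hf p hp).exists_hasSum_and_isBigO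
  have hcoeff (k : ℂ × ℕ) : ∑ p ∈ Λ, Function.extend (shiftExponent p) (b p) 0 k
      = Function.extend (shiftExponent (0, 0)) a 0 k := by
    have := sum_extend_shiftExponent_eq_zero (ι := Option Λ)
      (fun i ↦ i.elim (0, 0) (fun p ↦ p)) (fun i ↦ i.elim (-H) (fun p ↦ f p))
      (fun i ↦ i.elim (-a) (fun p ↦ b p)) ?_ ?_ k
    · have hneg : Function.extend (shiftExponent (0, 0)) (-a) 0
          = -Function.extend (shiftExponent (0, 0)) a 0 := by
        simpa using Function.extend_neg (shiftExponent (0, 0)) a 0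
      rw [Fintype.sum_option] at this
      simp only [Option.elim, hneg, Pi.neg_apply] at this
      rw [neg_add_eq_zero] at this
      rw [this, ← Finset.sum_coe_sort]
    · rintro (_ | p) N
      · simpa [neg_add_eq_sub] using (hH N).neg_left
      · exact (hbO p p.2 N).mono nhdsWithin_le_nhds
    · filter_upwards [hrep] with x hx
      rw [Fintype.sum_option]
      simp only [Option.elim, Pi.neg_apply, hx]
      rw [Finset.sum_coe_sort Λ fun p ↦ powLog p x * f p x]
      simp [powLog]
  filter_upwards [hrep, self_mem_nhdsWithin, nhdsWithin_le_nhds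
    ((Finset.eventually_all Λ).2 hbsum)] with x hx hx0 hxsum
  have key (p : ℂ × ℕ) (c : ℕ → ℂ) (v : ℂ) :
      HasSum (fun k ↦ powLog k x * Function.extend (shiftExponent p) c 0 k) v ↔
        HasSum (fun n ↦ powLog p x * x ^ n • c n) v := by
    have hinj := shiftExponent_injective p
    rw [← hasSum_extend_zero hinj]
    refine Iff.of_eq (congrArg (HasSum · v) (funext fun k ↦ ?_))
    rw [← hinj.extend_comp_mul (fun k ↦ powLog k x)]
    refine congrArg (Function.extend _ · _ _) (funext fun n ↦ ?_)
    rw [powLog_shiftExponent _ _ hx0, Complex.real_smul]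
    push_cast
    ring
  have hsum := hasSum_sum fun p hp ↦ (key p (b p) _).2 ((hxsum p hp).mul_left (powLog p x))
  simp only [← Finset.mul_sum, hcoeff, ← hx] at hsum
  simpa [powLog] using (key (0, 0) a _).1 hsum

theorem AnalyticAt.of_eventually_hasSum {F : ℝ → ℂ} {a : ℕ → ℂ}
    (h : ∀ᶠ x in 𝓝 0, HasSum (fun n ↦ x ^ n • a n) (F x)) : AnalyticAt ℝ F 0 := by
  refine ⟨fun n ↦ ContinuousMultilinearMap.mkPiRing ℝ (Fin n) (a n), hasFPowerSeriesAt_iff.2 ?_⟩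
  simpa [FormalMultilinearSeries.coeff] using h

theorem ContDiffOn.exists_isBigO_sub_sum_pow_smul {E : Type*} [NormedAddCommGroup E]
    [NormedSpace ℝ E] {F : ℝ → E} {s : Set ℝ} (hF : ContDiffOn ℝ (⊤ : ℕ∞) F s)
    (hs : Convex ℝ s) (h0 : s ∈ 𝓝 0) :
    ∃ a : ℕ → E, ∀ N,
      (fun x ↦ F x - ∑ n ∈ Finset.range N, x ^ n • a n) =O[𝓝 0] fun x : ℝ ↦ x ^ N := by
  refine ⟨fun n ↦ (n.factorial : ℝ)⁻¹ • iteratedDerivWithin n F s 0, fun N ↦ ?_⟩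
  have h1 := taylor_isLittleO (n := N) hs (mem_of_mem_nhds h0)
    (hF.of_le (by exact_mod_cast le_top))
  rw [nhdsWithin_eq_nhds.2 h0] at h1
  have h2 : (fun x : ℝ ↦ x ^ N • ((N.factorial : ℝ)⁻¹ • iteratedDerivWithin N F s 0))
      =O[𝓝 0] fun x : ℝ ↦ x ^ N := by
    simpa using (isBigO_refl (fun x : ℝ ↦ x ^ N) (𝓝 0)).smul
      (isBigO_const_const ((N.factorial : ℝ)⁻¹ • iteratedDerivWithin N F s 0)
        (one_ne_zero (α := ℝ)) (𝓝 0))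
  refine ((h1.isBigO.congr_right fun x ↦ by rw [sub_zero]).add h2).congr_left fun x ↦ ?_
  simp only [taylor_within_apply, Finset.sum_range_succ, sub_zero, smul_smul, mul_comm]
  abel

/-- A `C^∞` function on `(-ε, ε)` which is analytic away from `0` and admits expansions
`F(x) = Σ x^λ (log x)^j f_{λ,j}(x)` on `(0,ε)` and
`F(x) = Σ (-x)^λ (log(-x))^j g_{λ,j}(x)` on `(-ε,0)` (with analytic coefficient functions)
is analytic on all of `(-ε, ε)`. -/
theorem smooth_with_log_pow_expansions_is_analytic
    (ε : ℝ) (hε : 0 < ε) (F : ℝ → ℂ)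
    (hF : ContDiffOn ℝ (⊤ : ℕ∞) F (Ioo (-ε) ε))
    (hFanal : AnalyticOnNhd ℝ F (Ioo (-ε) 0 ∪ Ioo 0 ε))
    (Λ : Finset (ℂ × ℕ)) (f : ℂ × ℕ → ℝ → ℂ)
    (hfa : ∀ p ∈ Λ, AnalyticOnNhd ℝ (f p) (Ioo (-ε) ε))
    (hrep : ∀ x ∈ Ioo (0 : ℝ) ε,
      F x = ∑ p ∈ Λ, (x : ℂ) ^ p.1 * (Real.log x : ℂ) ^ p.2 * f p x)
    (Λ' : Finset (ℂ × ℕ)) (g : ℂ × ℕ → ℝ → ℂ)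
    (hga : ∀ p ∈ Λ', AnalyticOnNhd ℝ (g p) (Ioo (-ε) ε))
    (hrep' : ∀ x ∈ Ioo (-ε) (0 : ℝ),
      F x = ∑ p ∈ Λ', ((-x : ℝ) : ℂ) ^ p.1 * (Real.log (-x) : ℂ) ^ p.2 * g p x) :
    AnalyticOnNhd ℝ F (Ioo (-ε) ε) := by
  have hnhds : Ioo (-ε) ε ∈ 𝓝 (0 : ℝ) := Ioo_mem_nhds (neg_lt_zero.2 hε) hε
  obtain ⟨a, ha⟩ := hF.exists_isBigO_sub_sum_pow_smul (convex_Ioo _ _) hnhds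
  have hneg : Tendsto (fun x : ℝ ↦ -x) (𝓝 0) (𝓝 0) := by
    simpa using (continuous_neg (G := ℝ)).tendsto 0
  have hright : ∀ᶠ x in 𝓝[>] 0, HasSum (fun n ↦ x ^ n • a n) (F x) := by
    refine eventually_hasSum_of_eventually_eq_sum_powLog (fun N ↦ (ha N).mono nhdsWithin_le_nhds)
      Λ (fun p hp ↦ hfa p hp 0 (mem_of_mem_nhds hnhds)) ?_
    filter_upwards [Ioo_mem_nhdsGT hε] with x hx
    exact hrep x hx
  have hleft : ∀ᶠ x in 𝓝[>] 0, HasSum (fun n ↦ x ^ n • ((-1 : ℝ) ^ n • a n)) (F (-x)) := by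
    refine eventually_hasSum_of_eventually_eq_sum_powLog (fun N ↦ ?_) Λ'
      (f := fun p x ↦ g p (-x)) (fun p hp ↦ ?_) ?_
    · refine ((((ha N).comp_tendsto hneg).trans
        (isBigO_of_le _ fun x ↦ ?_)).congr_left fun x ↦ ?_).mono nhdsWithin_le_nhds
      · simp
      · simp only [Function.comp, smul_smul, ← mul_pow, mul_neg_one]
    · refine AnalyticAt.fun_comp ?_ analyticAt_id.neg
      simpa using hga p hp 0 (mem_of_mem_nhds hnhds)
    · filter_upwards [Ioo_mem_nhdsGT hε] with x hx
      simpa [powLog] using hrep' (-x) ⟨neg_lt_neg hx.2, neg_lt_zero.2 hx.1⟩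
  have hzero : HasSum (fun n ↦ (0 : ℝ) ^ n • a n) (F 0) := by
    obtain ⟨C, hC⟩ := (ha 1).bound
    have h0 : F 0 = a 0 := by simpa [sub_eq_zero] using hC.self_of_nhds
    rw [h0]
    simpa using hasSum_single (f := fun n ↦ (0 : ℝ) ^ n • a n) 0 fun n hn ↦ by simp [hn]
  intro x hx
  rcases lt_trichotomy x 0 with hlt | rfl | hgt
  · exact hFanal x (.inl ⟨hx.1, hlt⟩)
  · refine AnalyticAt.of_eventually_hasSum (a := a) ?_
    rw [eventually_nhdsWithin_iff] at hright hleft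
    filter_upwards [hright, hneg.eventually hleft] with x hxr hxl
    rcases lt_trichotomy x 0 with hlt | rfl | hgt
    · simpa only [smul_smul, ← mul_pow, mul_neg_one, neg_neg] using hxl (neg_pos.2 hlt)
    · exact hzero
    · exact hxr hgt
  · exact hFanal x (.inr ⟨hgt, hx.2⟩)
end

section
/- Let ε > 0, let Λ ⊂ ℂ × ℤ_{≥0} be a finite set, and for each (λ,j) ∈ Λ let f_{λ,j} : (−ε,ε) → ℂ be real-analytic with f_{λ,j}(0) ≠ 0. Suppose F : (−ε,ε) → ℂ is a C^∞ function such that F(x) = Σ_{(λ,j)∈Λ} x^λ (log x)^j f_{λ,j}(x) for all x ∈ (0,ε). Then for every (λ,j) ∈ Λ the exponent λ is a nonnegative integer. -/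
set_option autoImplicit false

open Set Filter Topology Polynomial

/-- A complex polynomial that tends to zero along the real half-line is zero. -/
theorem polynomial_eq_zero_of_tendsto_zero {P : ℂ[X]}
    (h : Tendsto (fun t : ℝ => P.eval (t : ℂ)) atTop (𝓝 0)) : P = 0 := by
  by_cases hd : 0 < P.degree
  · have hz : Tendsto (fun t : ℝ => ‖(t : ℂ)‖) atTop atTop := by
      simpa using tendsto_abs_atTop_atTop
    exact absurd (tendsto_norm_zero.comp h)
      (not_tendsto_nhds_of_tendsto_atTop (P.tendsto_norm_atTop hd hz) 0)
  · rw [eq_C_of_degree_le_zero (not_lt.mp hd)] at h ⊢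
    simp only [eval_C, tendsto_const_nhds_iff] at h
    rw [h, C_0]

theorem exists_forall_exp_mul_ne (S : Finset ℂ) (μ : ℂ) :
    ∃ τ : ℝ, ∀ ν ∈ S, ν ≠ μ → Complex.exp (ν * τ) ≠ Complex.exp (μ * τ) := by
  have h : ∀ ν ∈ S, ∀ᶠ τ : ℝ in 𝓝[≠] 0,
      ν ≠ μ → Complex.exp (ν * τ) ≠ Complex.exp (μ * τ) := by
    intro ν _
    by_cases hν : ν = μ
    · simp [hν]
    have hlin : HasDerivAt (fun τ : ℝ => (ν - μ) * (τ : ℂ)) (ν - μ) 0 := by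
      simpa using (Complex.ofRealCLM.hasDerivAt (x := (0 : ℝ))).const_mul (ν - μ)
    have hd : HasDerivAt (fun τ : ℝ => Complex.exp ((ν - μ) * τ)) (ν - μ) 0 := by
      simpa using hlin.cexp
    filter_upwards [hd.eventually_ne (c := 1) (sub_ne_zero.mpr hν)] with τ hτ _ heq
    apply hτ
    rw [sub_mul, Complex.exp_sub, heq, div_self (Complex.exp_ne_zero _)]
  exact ((Finset.eventually_all S).mpr h).exists

/-- Exponential polynomials whose exponents have nonnegative real part do not tend to zero at
infinity unless all their coefficients vanish. -/
theorem eq_zero_of_tendsto_sum_exp_mul (S : Finset ℂ) (hS : ∀ ν ∈ S, 0 ≤ ν.re) (n : ℕ) :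
    ∀ (d : ℂ → ℕ) (P : ℂ → ℂ[X]), ∑ ν ∈ S, d ν = n → (∀ ν ∈ S, (P ν).degree < d ν) →
      Tendsto (fun t : ℝ => ∑ ν ∈ S, Complex.exp (ν * t) * (P ν).eval (t : ℂ)) atTop (𝓝 0) →
      ∀ ν ∈ S, P ν = 0 := by
  induction n using Nat.strong_induction_on with
  | _ n ih =>
  intro d P hn hd ht
  by_contra! hne
  obtain ⟨μ, hμ, hPμ⟩ := hne
  obtain ⟨τ, hτ⟩ := exists_forall_exp_mul_ne S μ
  let Q : ℂ → ℂ[X] := fun ν =>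
    C (Complex.exp (ν * τ)) * taylor (τ : ℂ) (P ν) - C (Complex.exp (μ * τ)) * P ν
  have hQt : Tendsto (fun t : ℝ => ∑ ν ∈ S, Complex.exp (ν * t) * (Q ν).eval (t : ℂ))
      atTop (𝓝 0) := by
    have hs := (ht.comp (tendsto_atTop_add_const_right atTop τ tendsto_id)).sub
      (ht.const_mul (Complex.exp (μ * τ)))
    rw [mul_zero, sub_zero] at hs
    refine hs.congr fun t => ?_
    simp only [Function.comp, id, Finset.mul_sum, ← Finset.sum_sub_distrib]
    refine Finset.sum_congr rfl fun ν _ => ?_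
    simp only [Q, eval_sub, eval_mul, eval_C, taylor_eval, Complex.ofReal_add, mul_add,
      Complex.exp_add]
    ring
  have hQle : ∀ ν, (Q ν).degree ≤ (P ν).degree := by
    intro ν
    refine (degree_sub_le _ _).trans (max_le ?_ ?_)
    · rw [degree_C_mul (Complex.exp_ne_zero _), degree_taylor]
    · rw [degree_C_mul (Complex.exp_ne_zero _)]
  have hQlt : (Q μ).degree < (P μ).degree := by
    have h := degree_sub_lt_left (degree_taylor (P μ) (τ : ℂ))
      (fun h0 => hPμ ((taylor_eq_zero _ _).mp h0)) (leadingCoeff_taylor _ _)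
    rw [degree_taylor] at h
    simp only [Q, ← mul_sub]
    rwa [degree_C_mul (Complex.exp_ne_zero _)]
  have hdμ := hd μ hμ
  rw [degree_eq_natDegree hPμ, Nat.cast_lt] at hdμ
  have hQ0 : ∀ ν ∈ S, Q ν = 0 := by
    refine ih (∑ ν ∈ S, Function.update d μ (d μ - 1) ν) ?_ _ Q rfl ?_ hQt
    · rw [← hn]
      refine Finset.sum_lt_sum (fun ν _ => ?_) ⟨μ, hμ, ?_⟩
      · by_cases h : ν = μ
        · subst h; simp
        · simp [h]
      · simp only [Function.update_self]; omega
    · intro ν hν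
      by_cases h : ν = μ
      · subst h
        rw [Function.update_self]
        refine hQlt.trans_le ?_
        rw [degree_eq_natDegree hPμ, Nat.cast_le]
        omega
      · rw [Function.update_of_ne h]
        exact (hQle ν).trans_lt (hd ν hν)
  have hP0 : ∀ ν ∈ S, ν ≠ μ → P ν = 0 := by
    intro ν hν hνμ
    by_contra hP
    have hlc := congrArg leadingCoeff (sub_eq_zero.mp (hQ0 ν hν))
    simp only [leadingCoeff_mul, leadingCoeff_C, leadingCoeff_taylor] at hlc
    exact hτ ν hν hνμ (mul_right_cancel₀ (leadingCoeff_ne_zero.mpr hP) hlc)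
  have hsingle : Tendsto (fun t : ℝ => Complex.exp (μ * t) * (P μ).eval (t : ℂ)) atTop (𝓝 0) := by
    refine ht.congr fun t => Finset.sum_eq_single_of_mem μ hμ fun ν hν hνμ => ?_
    rw [hP0 ν hν hνμ, eval_zero, mul_zero]
  refine hPμ (polynomial_eq_zero_of_tendsto_zero (squeeze_zero_norm' ?_
    (tendsto_zero_iff_norm_tendsto_zero.mp hsingle)))
  filter_upwards [eventually_ge_atTop 0] with t ht0
  rw [norm_mul, Complex.norm_exp]
  refine le_mul_of_one_le_left (norm_nonneg _) (Real.one_le_exp ?_)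
  simpa using mul_nonneg (hS μ hμ) ht0

theorem tendsto_exp_mul_pow_zero {b : ℝ} (hb : b < 0) (j : ℕ) :
    Tendsto (fun t : ℝ => Real.exp (b * t) * t ^ j) atTop (𝓝 0) := by
  have h := tendsto_rpow_mul_exp_neg_mul_atTop_nhds_zero j (-b) (neg_pos.mpr hb)
  refine h.congr fun t => ?_
  rw [Real.rpow_natCast, neg_neg, mul_comm]

theorem tendsto_exp_mul_eval_zero {ν : ℂ} (hν : ν.re < 0) (P : ℂ[X]) :
    Tendsto (fun t : ℝ => Complex.exp (ν * t) * P.eval (t : ℂ)) atTop (𝓝 0) := by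
  simp only [eval_eq_sum_range, Finset.mul_sum]
  rw [← Finset.sum_const_zero (s := Finset.range (P.natDegree + 1))]
  refine tendsto_finsetSum _ fun k _ => ?_
  rw [tendsto_zero_iff_norm_tendsto_zero]
  have h := (tendsto_exp_mul_pow_zero hν k).norm.const_mul ‖P.coeff k‖
  rw [norm_zero, mul_zero] at h
  refine h.congr fun t => ?_
  simp [Complex.norm_exp]
  ring

/-- In an exponential polynomial tending to zero at infinity, the coefficient of an exponent
with nonnegative real part vanishes. -/
theorem sum_filter_eq_zero_of_tendsto {ι : Type*} (I : Finset ι) (e : ι → ℂ) (P : ι → ℂ[X])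
    (h : Tendsto (fun t : ℝ => ∑ i ∈ I, Complex.exp (e i * t) * (P i).eval (t : ℂ))
      atTop (𝓝 0)) {μ : ℂ} (hμ : 0 ≤ μ.re) :
    ∑ i ∈ I with e i = μ, P i = 0 := by
  classical
  let J := I.filter fun i => 0 ≤ (e i).re
  let R : ℂ → ℂ[X] := fun ν => ∑ i ∈ I with e i = ν, P i
  have hsmall : Tendsto (fun t : ℝ => ∑ i ∈ I with ¬ 0 ≤ (e i).re,
      Complex.exp (e i * t) * (P i).eval (t : ℂ)) atTop (𝓝 0) := by
    rw [← Finset.sum_const_zero (M := ℂ) (s := I.filter fun i => ¬ 0 ≤ (e i).re)]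
    refine tendsto_finsetSum _ fun i hi => ?_
    exact tendsto_exp_mul_eval_zero (not_le.mp (Finset.mem_filter.mp hi).2) _
  have hlarge : Tendsto (fun t : ℝ => ∑ ν ∈ J.image e,
      Complex.exp (ν * t) * (R ν).eval (t : ℂ)) atTop (𝓝 0) := by
    have hs := h.sub hsmall
    rw [sub_zero] at hs
    refine hs.congr fun t => ?_
    have hsplit := Finset.sum_filter_add_sum_filter_not I (fun i => 0 ≤ (e i).re)
      (fun i => Complex.exp (e i * t) * (P i).eval (t : ℂ))
    have hfib := Finset.sum_fiberwise_of_maps_to (fun i hi => Finset.mem_image_of_mem e hi)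
      (s := J) (fun i => Complex.exp (e i * t) * (P i).eval (t : ℂ))
    rw [← hsplit, add_sub_cancel_right, ← hfib]
    refine Finset.sum_congr rfl fun ν hν => ?_
    obtain ⟨k, hk, rfl⟩ := Finset.mem_image.mp hν
    have hfil : J.filter (fun i => e i = e k) = I.filter fun i => e i = e k := by
      ext i
      simp only [J, Finset.mem_filter]
      refine ⟨fun hi => ⟨hi.1.1, hi.2⟩, fun hi => ⟨⟨hi.1, ?_⟩, hi.2⟩⟩
      rw [hi.2]
      exact (Finset.mem_filter.mp hk).2
    simp only [R, eval_finsetSum, Finset.mul_sum]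
    rw [hfil]
    refine Finset.sum_congr rfl fun i hi => ?_
    rw [(Finset.mem_filter.mp hi).2]
  have hzero := eq_zero_of_tendsto_sum_exp_mul (J.image e)
    (by
      intro ν hν
      obtain ⟨k, hk, rfl⟩ := Finset.mem_image.mp hν
      exact (Finset.mem_filter.mp hk).2)
    _ (fun ν => (R ν).natDegree + 1) R rfl
    (fun ν _ => degree_le_natDegree.trans_lt (by exact_mod_cast Nat.lt_succ_self _)) hlarge
  by_cases hmem : μ ∈ J.image e
  · exact hzero μ hmem
  · refine Finset.sum_eq_zero fun i hi => ?_
    obtain ⟨hiI, rfl⟩ := Finset.mem_filter.mp hi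
    exact absurd (Finset.mem_image_of_mem e (Finset.mem_filter.mpr ⟨hiI, hμ⟩)) hmem

theorem exists_taylor_coeff_bound {g : ℝ → ℂ} {a : ℝ} (ha : 0 ≤ a) (n : ℕ)
    (hg : ContDiffOn ℝ (n + 1) g (Icc 0 a)) :
    ∃ (c : ℕ → ℂ) (K : ℝ), c 0 = g 0 ∧ ∀ x ∈ Icc (0 : ℝ) a,
      ‖g x - ∑ k ∈ Finset.range (n + 1), c k * (x : ℂ) ^ k‖ ≤ K * x ^ (n + 1) := by
  obtain ⟨K, hK⟩ := exists_taylor_mean_remainder_bound ha hg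
  refine ⟨fun k => (k.factorial : ℂ)⁻¹ * iteratedDerivWithin k g (Icc 0 a) 0, K, by simp,
    fun x hx => ?_⟩
  have h := hK x hx
  rw [sub_zero, taylor_within_apply] at h
  refine le_of_eq_of_le (congrArg (fun z => ‖g x - z‖) (Finset.sum_congr rfl fun k _ => ?_)) h
  rw [sub_zero, Complex.real_smul]
  push_cast
  ring

/-- Suppose `∑ x ^ e i * (log x) ^ j i * g i x` vanishes for small `x > 0`, with `g i` smooth up to
`0`. If the exponent `μ` is not of the form `e i + k` with `k ≥ 1`, then the leading coefficients
of the terms with `e i = μ` cancel separately for each power of the logarithm. -/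
theorem sum_filter_leading_coeff_eq_zero {ι : Type*} (I : Finset ι) (e : ι → ℂ) (j : ι → ℕ)
    (g : ι → ℝ → ℂ) {a : ℝ} (ha : 0 < a)
    (hg : ∀ i ∈ I, ContDiffOn ℝ (⊤ : ℕ∞) (g i) (Icc 0 a))
    (hsum : ∀ x ∈ Ioc 0 a, ∑ i ∈ I, (x : ℂ) ^ e i * (Real.log x : ℂ) ^ j i * g i x = 0)
    (μ : ℂ) (hμ : ∀ i ∈ I, ∀ k : ℕ, k ≠ 0 → e i + k ≠ μ) :
    ∑ i ∈ I with e i = μ, C (g i 0) * (-X) ^ j i = 0 := by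
  classical
  obtain ⟨n, hn⟩ : ∃ n : ℕ, ∀ i ∈ I, (μ - e i).re - (n + 1) < 0 := by
    obtain ⟨B, hB⟩ := (I.image fun i => (μ - e i).re).bddAbove
    obtain ⟨n, hn⟩ := exists_nat_ge B
    refine ⟨n, fun i hi => ?_⟩
    have := hB (Finset.mem_coe.mpr (Finset.mem_image_of_mem _ hi))
    linarith
  have htaylor : ∀ i, ∃ (c : ℕ → ℂ) (K : ℝ), i ∈ I → c 0 = g i 0 ∧ ∀ x ∈ Icc (0 : ℝ) a,
      ‖g i x - ∑ k ∈ Finset.range (n + 1), c k * (x : ℂ) ^ k‖ ≤ K * x ^ (n + 1) := by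
    intro i
    by_cases hi : i ∈ I
    · obtain ⟨c, K, h⟩ := exists_taylor_coeff_bound ha.le n
        ((hg i hi).of_le (by exact_mod_cast le_top))
      exact ⟨c, K, fun _ => h⟩
    · exact ⟨0, 0, fun h => absurd h hi⟩
  choose c K hcK using htaylor
  have hexp : ∀ᶠ t : ℝ in atTop, Real.exp (-t) ∈ Ioc 0 a := by
    have h := Real.tendsto_exp_neg_atTop_nhds_zero.eventually (Iic_mem_nhds ha)
    filter_upwards [h] with t ht using ⟨Real.exp_pos _, ht⟩
  have hrem : ∀ i ∈ I, Tendsto (fun t : ℝ => Complex.exp ((μ - e i) * t) * (-(t : ℂ)) ^ j i *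
      (g i (Real.exp (-t)) - ∑ k ∈ Finset.range (n + 1), c i k * (Real.exp (-t) : ℂ) ^ k))
      atTop (𝓝 0) := by
    intro i hi
    have hb := (tendsto_exp_mul_pow_zero (hn i hi) (j i)).norm.const_mul (K i)
    rw [norm_zero, mul_zero] at hb
    refine squeeze_zero_norm' ?_ hb
    filter_upwards [hexp] with t ht
    rw [norm_mul]
    refine (mul_le_mul_of_nonneg_left ((hcK i hi).2 _ (Ioc_subset_Icc_self ht))
      (norm_nonneg _)).trans_eq ?_
    have hsplit : Real.exp (((μ - e i).re - (n + 1)) * t) =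
        Real.exp ((μ - e i).re * t) * Real.exp (-t) ^ (n + 1) := by
      rw [← Real.exp_nat_mul, ← Real.exp_add]
      congr 1
      push_cast
      ring
    rw [hsplit]
    simp only [norm_mul, norm_pow, norm_neg, Complex.norm_exp, Complex.norm_real,
      Complex.re_mul_ofReal, Real.norm_eq_abs, Real.abs_exp]
    ring
  let E : ι × ℕ → ℂ := fun q => μ - e q.1 - q.2
  let P : ι × ℕ → ℂ[X] := fun q => C (c q.1 q.2) * (-X) ^ j q.1
  have hmain : Tendsto (fun t : ℝ => ∑ q ∈ I ×ˢ Finset.range (n + 1),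
      Complex.exp (E q * t) * (P q).eval (t : ℂ)) atTop (𝓝 0) := by
    have hs := (tendsto_finsetSum I hrem).neg
    rw [Finset.sum_const_zero, neg_zero] at hs
    refine hs.congr' ?_
    filter_upwards [hexp] with t ht
    have hzero := congrArg (fun z => Complex.exp (μ * t) * z) (hsum _ ht)
    have hcpow : ∀ z : ℂ, ((Real.exp (-t) : ℝ) : ℂ) ^ z = Complex.exp (-z * t) := by
      intro z
      rw [Complex.cpow_def_of_ne_zero (by exact_mod_cast ht.1.ne'), ← Complex.ofReal_log ht.1.le,
        Real.log_exp]
      congr 1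
      push_cast
      ring
    simp only [mul_zero, Finset.mul_sum, hcpow, Real.log_exp] at hzero
    rw [Finset.sum_product, neg_eq_iff_add_eq_zero, ← Finset.sum_add_distrib, ← hzero]
    refine Finset.sum_congr rfl fun i _ => ?_
    have hpart : ∑ k ∈ Finset.range (n + 1), Complex.exp (E (i, k) * t) * (P (i, k)).eval (t : ℂ) =
        Complex.exp ((μ - e i) * t) * (-(t : ℂ)) ^ j i *
          ∑ k ∈ Finset.range (n + 1), c i k * (Real.exp (-t) : ℂ) ^ k := by
      rw [Finset.mul_sum]
      refine Finset.sum_congr rfl fun k _ => ?_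
      have hE : Complex.exp (E (i, k) * t) =
          Complex.exp ((μ - e i) * t) * (Real.exp (-t) : ℂ) ^ k := by
        rw [Complex.ofReal_exp, ← Complex.exp_nat_mul, ← Complex.exp_add]
        congr 1
        simp only [E]
        push_cast
        ring
      rw [hE]
      simp only [P, eval_mul, eval_C, eval_pow, eval_neg, eval_X]
      ring
    rw [hpart, ← mul_add, sub_add_cancel, sub_mul, sub_eq_add_neg, Complex.exp_add, ← neg_mul,
      Complex.ofReal_neg]
    ring
  have hcoeff := sum_filter_eq_zero_of_tendsto _ E P hmain (μ := 0) le_rfl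
  rw [← hcoeff]
  refine Finset.sum_bij (fun i _ => (i, 0)) ?_ ?_ ?_ ?_
  · intro i hi
    obtain ⟨hiI, hie⟩ := Finset.mem_filter.mp hi
    simp [E, hiI, hie]
  · intro i _ i' _ h
    exact congrArg Prod.fst h
  · rintro ⟨i, k⟩ hq
    simp only [E, Finset.mem_filter, Finset.mem_product] at hq
    obtain ⟨⟨hi, _⟩, hE⟩ := hq
    have hμk : e i + k = μ := by linear_combination -hE
    obtain rfl : k = 0 := by
      by_contra hk
      exact hμ i hi k hk hμk
    exact ⟨i, Finset.mem_filter.mpr ⟨hi, by simpa using hμk⟩, rfl⟩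
  · intro i hi
    simp only [P]
    rw [(hcK i (Finset.mem_filter.mp hi).1).1]

/-- If a `C^∞` function on `(-ε,ε)` admits an expansion
`F(x) = Σ_{(λ,j)∈Λ} x^λ (log x)^j f_{λ,j}(x)` on `(0,ε)` with analytic coefficient functions
`f_{λ,j}` satisfying `f_{λ,j}(0) ≠ 0`, then every exponent `λ` is a nonnegative integer. -/
theorem exponents_of_smooth_log_pow_expansion_are_nat
    (ε : ℝ) (hε : 0 < ε)
    (Λ : Finset (ℂ × ℕ)) (f : ℂ × ℕ → ℝ → ℂ)
    (hfa : ∀ p ∈ Λ, AnalyticOnNhd ℝ (f p) (Ioo (-ε) ε))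
    (hf0 : ∀ p ∈ Λ, f p 0 ≠ 0)
    (F : ℝ → ℂ)
    (hF : ContDiffOn ℝ (⊤ : ℕ∞) F (Ioo (-ε) ε))
    (hrep : ∀ x ∈ Ioo (0 : ℝ) ε,
      F x = ∑ p ∈ Λ, (x : ℂ) ^ p.1 * (Real.log x : ℂ) ^ p.2 * f p x) :
    ∀ p ∈ Λ, ∃ n : ℕ, p.1 = (n : ℂ) := by
  by_contra! hcon
  obtain ⟨p₀, hp₀, hp₀n⟩ := hcon
  classical
  obtain ⟨q, hq, hqmin⟩ := (Λ.filter fun p => ∀ n : ℕ, p.1 ≠ (n : ℂ)).exists_min_image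
    (fun p => p.1.re) ⟨p₀, Finset.mem_filter.mpr ⟨hp₀, hp₀n⟩⟩
  obtain ⟨hqΛ, hqn⟩ := Finset.mem_filter.mp hq
  have hsub : Icc 0 (ε / 2) ⊆ Ioo (-ε) ε := fun x hx => ⟨by linarith [hx.1], by linarith [hx.2]⟩
  have hlead := sum_filter_leading_coeff_eq_zero Λ.insertNone
    (fun o => o.elim 0 Prod.fst) (fun o => o.elim 0 Prod.snd) (fun o => o.elim (-F) f)
    (half_pos hε) ?_ ?_ q.1 ?_
  · have hq0 : (0 : ℂ) ≠ q.1 := fun h => hqn 0 (by simp [← h])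
    have hpoly : ∑ p ∈ Λ, (if p.1 = q.1 then C (f p 0) * (-X) ^ p.2 else 0) = 0 := by
      refine Eq.trans ?_ hlead
      rw [Finset.sum_filter, Finset.sum_insertNone, if_neg (by exact hq0), zero_add]
      exact Finset.sum_congr rfl fun p _ => by by_cases h : p.1 = q.1 <;> simp [h]
    have hc := congrArg (fun P : ℂ[X] => P.coeff q.2) hpoly
    simp only [finsetSum_coeff, coeff_zero] at hc
    rw [Finset.sum_eq_single_of_mem q hqΛ] at hc
    · rw [if_pos rfl, neg_pow, ← C_1, ← C_neg, ← C_pow, ← mul_assoc, ← C_mul, coeff_C_mul_X_pow,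
        if_pos rfl] at hc
      exact hf0 q hqΛ (by simpa using hc)
    · intro p _ hpq
      split_ifs with h
      · have h2 : q.2 ≠ p.2 := fun h2 => hpq (Prod.ext h h2.symm)
        rw [neg_pow, ← C_1, ← C_neg, ← C_pow, ← mul_assoc, ← C_mul, coeff_C_mul_X_pow, if_neg h2]
      · rfl
  · intro o ho
    cases o with
    | none => exact hF.neg.mono hsub
    | some p =>
      exact (hfa p (Finset.some_mem_insertNone.mp ho)).analyticOn.contDiffOn
        (uniqueDiffOn_Ioo _ _) |>.mono hsub
  · intro x hx
    rw [Finset.sum_insertNone]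
    simp [hrep x ⟨hx.1, by linarith [hx.2]⟩]
  · intro o ho k hk heq
    cases o with
    | none => exact hqn k (by simpa using heq.symm)
    | some p =>
      have hp : ∀ n : ℕ, p.1 ≠ (n : ℂ) := fun n hn => hqn (n + k) (by
        rw [← heq, Option.elim, hn]; push_cast; rfl)
      have hle := hqmin p (Finset.mem_filter.mpr ⟨Finset.some_mem_insertNone.mp ho, hp⟩)
      rw [← heq] at hle
      simp only [Option.elim, Complex.add_re, Complex.natCast_re] at hle
      have hk1 : (0 : ℝ) < k := by exact_mod_cast Nat.pos_of_ne_zero hk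
      linarith
end

section
/- Let ε > 0, let J ⊂ ℤ_{≥0} be a finite set, and for each j ∈ J let n_j ∈ ℤ_{≥0} and let f_j : (−ε,ε) → ℂ be real-analytic with f_j(0) ≠ 0. Suppose F : (−ε,ε) → ℂ is a C^∞ function such that F(x) = Σ_{j∈J} x^{n_j} (log x)^j f_j(x) for all x ∈ (0,ε). Then J ⊆ {0}; that is, no genuinely logarithmic term can occur in such an expansion of a C^∞ function. -/
set_option autoImplicit false

open Set

open Filter Topology Asymptotics

theorem ContDiffOn.exists_isBigO_sub_sum_pow {ε : ℝ} (hε : 0 < ε) {g : ℝ → ℂ}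
    (hg : ContDiffOn ℝ (⊤ : ℕ∞) g (Ioo (-ε) ε)) :
    ∃ a : ℕ → ℂ, ∀ n : ℕ,
      (fun x : ℝ => g x - ∑ k ∈ Finset.range n, (x : ℂ) ^ k * a k)
        =O[𝓝[>] 0] fun x : ℝ => x ^ n := by
  refine ⟨fun k => ((k.factorial : ℝ)⁻¹ : ℝ) • iteratedDerivWithin k g (Ioo (-ε) ε) 0,
    fun n => ?_⟩
  have hnhds : 𝓝[Ioo (-ε) ε] (0 : ℝ) = 𝓝 0 :=
    nhdsWithin_eq_nhds.2 (Ioo_mem_nhds (neg_neg_iff_pos.2 hε) hε)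
  have htaylor := (taylor_isLittleO (n := n) (convex_Ioo (-ε) ε)
    (show (0 : ℝ) ∈ Ioo (-ε) ε by simpa using hε)
    (hg.of_le (by exact_mod_cast le_top))).isBigO
  rw [hnhds] at htaylor
  simp only [taylor_within_apply, sub_zero, Finset.sum_range_succ] at htaylor
  have hlast : (fun x : ℝ => ((n.factorial : ℝ)⁻¹ * x ^ n) •
      iteratedDerivWithin n g (Ioo (-ε) ε) 0) =O[𝓝 0] fun x : ℝ => x ^ n := by
    refine IsBigO.of_bound (‖((n.factorial : ℝ)⁻¹)‖ * ‖iteratedDerivWithin n g (Ioo (-ε) ε) 0‖)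
      (Eventually.of_forall fun x => le_of_eq ?_)
    rw [norm_smul, norm_mul]
    ring
  refine ((htaylor.add hlast).mono nhdsWithin_le_nhds).congr_left fun x => ?_
  rw [← sub_sub, sub_add_cancel]
  congr 1
  refine Finset.sum_congr rfl fun k _ => ?_
  simp only [Complex.real_smul]
  push_cast
  ring

theorem Polynomial.eq_zero_of_tendsto_eval_log {p : Polynomial ℂ}
    (hp : Tendsto (fun x : ℝ => p.eval (Real.log x : ℂ)) (𝓝[>] 0) (𝓝 0)) : p = 0 := by
  by_cases hdeg : 0 < p.degree
  · have hlog : Tendsto (fun x : ℝ => ‖(Real.log x : ℂ)‖) (𝓝[>] 0) atTop := by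
      simpa [Function.comp_def] using tendsto_abs_atBot_atTop.comp Real.tendsto_log_nhdsGT_zero
    exact (not_tendsto_nhds_of_tendsto_atTop (p.tendsto_norm_atTop hdeg hlog) _ hp.norm).elim
  · rw [Polynomial.eq_C_of_degree_le_zero (not_lt.1 hdeg)] at hp ⊢
    simp only [Polynomial.eval_C, tendsto_const_nhds_iff] at hp
    simp [hp]

theorem tendsto_log_pow_mul_div_pow {r : ℝ → ℂ} {m : ℕ}
    (hr : r =O[𝓝[>] 0] fun x : ℝ => x ^ (m + 1)) (j : ℕ) :
    Tendsto (fun x : ℝ => (Real.log x : ℂ) ^ j * r x / (x : ℂ) ^ m) (𝓝[>] 0) (𝓝 0) := by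
  have hlog : (fun x : ℝ => (Real.log x : ℂ) ^ j) =o[𝓝[>] 0] fun x : ℝ => x⁻¹ := by
    have h := isLittleO_abs_log_rpow_rpow_nhdsGT_zero (j : ℝ) (neg_one_lt_zero)
    refine IsLittleO.of_norm_left (h.congr (fun x => ?_) fun x => Real.rpow_neg_one x)
    simp
  have hpow : (fun x : ℝ => ((x : ℂ) ^ m)⁻¹) =O[𝓝[>] 0] fun x : ℝ => (x ^ m)⁻¹ :=
    IsBigO.of_norm_left (by simpa using (isBigO_refl (fun x : ℝ => (x ^ m)⁻¹) _).norm_left)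
  refine (isLittleO_one_iff ℝ).1 (((hlog.mul_isBigO hr).mul_isBigO hpow).congr'
    (Eventually.of_forall fun x => (div_eq_mul_inv _ _).symm) ?_)
  filter_upwards [self_mem_nhdsWithin] with x hx
  have : x ≠ 0 := (mem_Ioi.1 hx).ne'
  field_simp
  ring

/-- The scale `x ^ m * (log x) ^ j` is independent: if functions `G j` with power asymptotic
expansions at `0⁺` satisfy `∑ (log x) ^ j * G j x = 0`, all coefficients vanish. -/
theorem coeff_eq_zero_of_sum_log_pow_mul_eq_zero {S : Finset ℕ} {G : ℕ → ℝ → ℂ} {a : ℕ → ℕ → ℂ}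
    (ha : ∀ j ∈ S, ∀ n : ℕ, (fun x : ℝ => G j x - ∑ k ∈ Finset.range n, (x : ℂ) ^ k * a j k)
      =O[𝓝[>] 0] fun x : ℝ => x ^ n)
    (hG : ∀ᶠ x : ℝ in 𝓝[>] 0, ∑ j ∈ S, (Real.log x : ℂ) ^ j * G j x = 0) (m : ℕ) :
    ∀ j ∈ S, a j m = 0 := by
  induction m using Nat.strong_induction_on with
  | _ m ih =>
    have hrem : ∀ j ∈ S, (fun x : ℝ => G j x - (x : ℂ) ^ m * a j m)
        =O[𝓝[>] 0] fun x : ℝ => x ^ (m + 1) := by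
      intro j hj
      refine (ha j hj (m + 1)).congr_left fun x => ?_
      rw [Finset.sum_range_succ, Finset.sum_eq_zero, zero_add]
      intro k hk
      rw [ih k (Finset.mem_range.1 hk) j hj, mul_zero]
    let p : Polynomial ℂ := ∑ j ∈ S, Polynomial.monomial j (a j m)
    have hp : p = 0 := by
      apply Polynomial.eq_zero_of_tendsto_eval_log
      have hlim := (tendsto_finsetSum S fun j hj =>
        tendsto_log_pow_mul_div_pow (hrem j hj) j).neg
      simp only [Finset.sum_const_zero, neg_zero] at hlim
      refine hlim.congr' ?_
      filter_upwards [hG, self_mem_nhdsWithin] with x hx hx0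
      have hxm : (x : ℂ) ^ m ≠ 0 := pow_ne_zero _ (Complex.ofReal_ne_zero.2 (mem_Ioi.1 hx0).ne')
      rw [← Finset.sum_div, neg_eq_iff_eq_neg, div_eq_iff hxm]
      simp only [mul_sub, Finset.sum_sub_distrib, hx, p, Polynomial.eval_finsetSum,
        Polynomial.eval_monomial, zero_sub, neg_mul, Finset.sum_mul]
      congr 1
      exact Finset.sum_congr rfl fun j _ => by ring
    intro j hj
    have hcoeff := congrArg (fun q => Polynomial.coeff q j) hp
    simpa [p, Polynomial.finsetSum_coeff, Polynomial.coeff_monomial, hj] using hcoeff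

/-- If a `C^∞` function on `(-ε,ε)` admits an expansion
`F(x) = Σ_{j∈J} x^{n_j} (log x)^j f_j(x)` on `(0,ε)` with analytic coefficient functions
`f_j` satisfying `f_j(0) ≠ 0`, then `J ⊆ {0}`: no genuinely logarithmic term occurs. -/
theorem no_log_terms_in_smooth_expansion
    (ε : ℝ) (hε : 0 < ε)
    (J : Finset ℕ) (n : ℕ → ℕ) (f : ℕ → ℝ → ℂ)
    (hfa : ∀ j ∈ J, AnalyticOnNhd ℝ (f j) (Ioo (-ε) ε))
    (hf0 : ∀ j ∈ J, f j 0 ≠ 0)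
    (F : ℝ → ℂ)
    (hF : ContDiffOn ℝ (⊤ : ℕ∞) F (Ioo (-ε) ε))
    (hrep : ∀ x ∈ Ioo (0 : ℝ) ε,
      F x = ∑ j ∈ J, (x : ℂ) ^ (n j) * (Real.log x : ℂ) ^ j * f j x) :
    J ⊆ {0} := by
  classical
  let G : ℕ → ℝ → ℂ := fun j x =>
    (if j ∈ J then (x : ℂ) ^ n j * f j x else 0) - if j = 0 then F x else 0
  have hGsmooth : ∀ j, ContDiffOn ℝ (⊤ : ℕ∞) (G j) (Ioo (-ε) ε) := by
    intro j
    refine ContDiffOn.sub ?_ ?_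
    · by_cases hj : j ∈ J
      · simp only [hj, if_true]
        exact (Complex.ofRealCLM.contDiff.pow (n j)).contDiffOn.mul
          ((hfa j hj).contDiffOn isOpen_Ioo.uniqueDiffOn)
      · simpa only [hj, if_false] using contDiffOn_const
    · by_cases hj : j = 0
      · simpa only [hj, if_true] using hF
      · simpa only [hj, if_false] using contDiffOn_const
  choose a ha using fun j => (hGsmooth j).exists_isBigO_sub_sum_pow hε
  have hsum : ∀ᶠ x : ℝ in 𝓝[>] 0, ∑ j ∈ insert 0 J, (Real.log x : ℂ) ^ j * G j x = 0 := by
    filter_upwards [Ioo_mem_nhdsGT hε] with x hx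
    simp only [G, mul_sub, Finset.sum_sub_distrib, mul_ite, mul_zero]
    rw [Finset.sum_ite_eq' (insert 0 J) 0, if_pos (Finset.mem_insert_self 0 J), pow_zero, one_mul,
      hrep x hx, sub_eq_zero, ← Finset.sum_filter]
    refine Finset.sum_congr (by ext; simp) fun j _ => by ring
  have hzero := fun m => coeff_eq_zero_of_sum_log_pow_mul_eq_zero (fun j _ => ha j) hsum m
  intro j hj
  by_contra hj0
  have hj0 : j ≠ 0 := by simpa using hj0
  have hflat : (fun x : ℝ => (x : ℂ) ^ n j * f j x) =O[𝓝[>] 0] fun x : ℝ => x ^ (n j + 1) := by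
    refine (ha j (n j + 1)).congr_left fun x => ?_
    rw [Finset.sum_eq_zero fun k _ => by rw [hzero k j (Finset.mem_insert_of_mem hj), mul_zero]]
    simp [G, hj, hj0]
  have hlim : Tendsto (f j) (𝓝[>] 0) (𝓝 0) := by
    refine (tendsto_log_pow_mul_div_pow hflat 0).congr' ?_
    filter_upwards [self_mem_nhdsWithin] with x hx
    have : (x : ℂ) ≠ 0 := Complex.ofReal_ne_zero.2 (mem_Ioi.1 hx).ne'
    field_simp
  have hcont : Tendsto (f j) (𝓝[>] 0) (𝓝 (f j 0)) :=
    ((hfa j hj 0 (by simpa using hε)).continuousAt.tendsto).mono_left nhdsWithin_le_nhds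
  exact hf0 j hj (tendsto_nhds_unique hcont hlim)
end

section
/- Let ε > 0, let Λ ⊂ ℂ × ℤ_{≥0} be a finite nonempty set, and for each (λ,j) ∈ Λ let h_{λ,j} : (−ε,ε) → ℂ be real-analytic with h_{λ,j}(0) ≠ 0. Assume λ° := min{Re λ : (λ,j) ∈ Λ} < 0. Then the function G(x) = Σ_{(λ,j)∈Λ} x^λ (log x)^j h_{λ,j}(x), defined for x ∈ (0,ε), satisfies limsup_{x→0+} |G(x)| = ∞; in particular G does not extend continuously to [0,ε). -/
set_option autoImplicit false

open Set

open Filter Topology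

/-- A trigonometric polynomial with distinct frequencies that tends to zero at infinity has
vanishing coefficients. -/
theorem coeff_eq_zero_of_tendsto_sum_exp {ι : Type*} (S : Finset ι) (ω : ι → ℝ)
    (hω : Set.InjOn ω S) (c : ι → ℂ)
    (hlim : Tendsto (fun t : ℝ => ∑ k ∈ S, c k * Complex.exp (ω k * t * Complex.I))
      atTop (𝓝 0)) :
    ∀ k ∈ S, c k = 0 := by
  classical
  induction S using Finset.induction_on generalizing c with
  | empty => simp
  | insert m S hm ih =>
    have hrest : ∀ k ∈ S, c k = 0 := by
      have key : ∀ s : ℝ, ∀ k ∈ S,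
          c k * (Complex.exp (ω k * s * Complex.I) - Complex.exp (ω m * s * Complex.I)) = 0 := by
        intro s
        apply ih (hω.mono (by simp))
        have hshift := (hlim.comp (tendsto_atTop_add_const_right atTop s tendsto_id)).sub
          (hlim.const_mul (Complex.exp (ω m * s * Complex.I)))
        simp only [mul_zero, sub_zero] at hshift
        refine hshift.congr fun t => ?_
        simp only [Function.comp_apply, id, Finset.sum_insert hm, mul_add, Finset.mul_sum,
          Complex.ofReal_add, add_mul, Complex.exp_add]
        rw [add_sub_add_comm, ← Finset.sum_sub_distrib]
        have h0 : c m * (Complex.exp (ω m * t * Complex.I) * Complex.exp (ω m * s * Complex.I)) -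
            Complex.exp (ω m * s * Complex.I) * (c m * Complex.exp (ω m * t * Complex.I)) = 0 := by
          ring
        rw [h0, zero_add]
        exact Finset.sum_congr rfl fun k _ => by ring
      intro k hk
      have hne : ω k - ω m ≠ 0 := by
        intro h0
        have := hω (by simp [hk]) (by simp) (sub_eq_zero.mp h0)
        exact hm (this ▸ hk)
      refine (mul_eq_zero.mp (key (Real.pi / (ω k - ω m)) k hk)).resolve_right fun h0 => ?_
      set s := Real.pi / (ω k - ω m) with hs
      have hexp : Complex.exp (ω k * s * Complex.I) =
          -Complex.exp (ω m * s * Complex.I) := by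
        have hr : ω k * s = ω m * s + Real.pi := by rw [hs]; field_simp; ring
        have hc : (ω k * s : ℂ) = ω m * s + Real.pi := by exact_mod_cast hr
        rw [hc, add_mul, Complex.exp_add, Complex.exp_pi_mul_I]
        ring
      rw [hexp] at h0
      have : Complex.exp (ω m * s * Complex.I) = 0 := by linear_combination (-1 / 2 : ℂ) * h0
      exact Complex.exp_ne_zero _ this
    have hcm : c m = 0 := by
      have hn := hlim.norm
      rw [norm_zero] at hn
      have hconst : Tendsto (fun _ : ℝ => ‖c m‖) atTop (𝓝 0) := by
        refine hn.congr fun t => ?_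
        rw [Finset.sum_insert hm, Finset.sum_eq_zero fun k hk => by rw [hrest k hk, zero_mul],
          add_zero, norm_mul]
        have := Complex.norm_exp_ofReal_mul_I (ω m * t)
        push_cast at this
        rw [this, mul_one]
      exact norm_eq_zero.mp (tendsto_nhds_unique tendsto_const_nhds hconst)
    intro k hk
    rcases Finset.mem_insert.mp hk with rfl | hk
    · exact hcm
    · exact hrest k hk

theorem tendsto_exp_neg_mul_pow_div_pow {b : ℝ} {j J : ℕ} (hb : 0 < b ∨ b = 0 ∧ j < J) :
    Tendsto (fun t : ℝ => Real.exp (-b * t) * t ^ j / t ^ J) atTop (𝓝 0) := by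
  rcases hb with hb | ⟨rfl, hj⟩
  · have h1 : Tendsto (fun t : ℝ => t ^ j * Real.exp (-b * t)) atTop (𝓝 0) := by
      simpa using tendsto_rpow_mul_exp_neg_mul_atTop_nhds_zero (j : ℝ) b hb
    refine squeeze_zero_norm' ?_ h1
    filter_upwards [eventually_ge_atTop 1] with t ht
    have ht0 : (0 : ℝ) ≤ t := by linarith
    rw [Real.norm_of_nonneg (by positivity), mul_comm (t ^ j)]
    exact div_le_self (by positivity) (one_le_pow₀ ht)
  · simpa using tendsto_pow_div_pow_atTop_zero (𝕜 := ℝ) hj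

theorem ofReal_exp_neg_cpow (t : ℝ) (z : ℂ) :
    ((Real.exp (-t) : ℝ) : ℂ) ^ z =
      (Real.exp (-z.re * t) : ℝ) * Complex.exp ((-z.im : ℝ) * t * Complex.I) := by
  rw [Complex.cpow_def_of_ne_zero (by exact_mod_cast (Real.exp_pos _).ne'),
    ← Complex.ofReal_log (Real.exp_pos _).le, Real.log_exp, Complex.ofReal_exp, ← Complex.exp_add]
  congr 1
  conv_lhs => rw [← Complex.re_add_im z]
  push_cast
  ring

/-- A finite sum of terms `x ^ λ * (log x) ^ j * h x` with some exponent of negative real part and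
coefficients having nonzero limits at `0` is unbounded near `0`. -/
theorem not_eventually_norm_sum_cpow_mul_log_pow_le
    (Λ : Finset (ℂ × ℕ)) (h : ℂ × ℕ → ℝ → ℂ) (l : ℂ × ℕ → ℂ)
    (hl : ∀ p ∈ Λ, Tendsto (h p) (𝓝[>] 0) (𝓝 (l p)))
    (hl0 : ∀ p ∈ Λ, l p ≠ 0)
    (hneg : ∃ p ∈ Λ, p.1.re < 0) (C : ℝ) :
    ¬ ∀ᶠ x : ℝ in 𝓝[>] 0,
      ‖∑ p ∈ Λ, (x : ℂ) ^ p.1 * (Real.log x : ℂ) ^ p.2 * h p x‖ ≤ C := by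
  classical
  intro hC
  obtain ⟨r, hr, hrneg⟩ := hneg
  obtain ⟨q, hq, hqmin⟩ := Finset.exists_min_image Λ (fun p => p.1.re) ⟨r, hr⟩
  have ha : q.1.re < 0 := (hqmin r hr).trans_lt hrneg
  have hqlead : q ∈ Λ.filter fun p => p.1.re = q.1.re := by simp [hq]
  obtain ⟨m, hm, hmmax⟩ := Finset.exists_max_image _ (fun p => p.2) ⟨q, hqlead⟩
  obtain ⟨hmΛ, hma⟩ := Finset.mem_filter.mp hm
  have hmin : ∀ p ∈ Λ, m.1.re ≤ p.1.re := fun p hp => hma ▸ hqmin p hp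
  have hmax : ∀ p ∈ Λ, p.1.re = m.1.re → p.2 ≤ m.2 := fun p hp hpa =>
    hmmax p (Finset.mem_filter.mpr ⟨hp, hpa.trans hma⟩)
  rw [← hma] at ha
  have hx : Tendsto (fun t : ℝ => Real.exp (-t)) atTop (𝓝[>] 0) :=
    Real.tendsto_exp_atBot_nhdsGT.comp tendsto_neg_atTop_atBot
  let w : ℝ → ℝ := fun t => Real.exp (m.1.re * t) / t ^ m.2
  let summand : ℂ × ℕ → ℝ → ℂ := fun p x =>
    (x : ℂ) ^ p.1 * (Real.log x : ℂ) ^ p.2 * h p x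
  let lead : ℂ × ℕ → Prop := fun p => p.1.re = m.1.re ∧ p.2 = m.2
  let osc : ℂ × ℕ → ℝ → ℂ := fun p t => Complex.exp ((-p.1.im : ℝ) * t * Complex.I)
  have hosc : ∀ p t, ‖osc p t‖ = 1 := fun p t => by
    simpa [osc] using Complex.norm_exp_ofReal_mul_I (-p.1.im * t)
  have hsummand : ∀ p t, (w t : ℂ) * summand p (Real.exp (-t)) =
      (Real.exp (-(p.1.re - m.1.re) * t) * t ^ p.2 / t ^ m.2 : ℝ) *
        (osc p t * ((-1) ^ p.2 * h p (Real.exp (-t)))) := by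
    intro p t
    have he : Real.exp (-(p.1.re - m.1.re) * t) =
        Real.exp (m.1.re * t) * Real.exp (-p.1.re * t) := by
      rw [← Real.exp_add]; ring_nf
    simp only [summand, w, osc]
    rw [ofReal_exp_neg_cpow, Real.log_exp, he, show ((-t : ℝ) : ℂ) ^ p.2 = (-1) ^ p.2 * (t : ℂ) ^ p.2 by
        rw [Complex.ofReal_neg, neg_pow]]
    push_cast
    ring
  have hsum : Tendsto (fun t => (w t : ℂ) * ∑ p ∈ Λ, summand p (Real.exp (-t))) atTop (𝓝 0) := by
    have hw : Tendsto w atTop (𝓝 0) := by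
      simpa [w] using tendsto_exp_neg_mul_pow_div_pow (b := -m.1.re) (j := 0) (J := m.2)
        (Or.inl (neg_pos.mpr ha))
    refine squeeze_zero_norm' (a := fun t => ‖w t‖ * C) ?_ (by simpa using hw.norm.mul_const C)
    filter_upwards [hx.eventually hC] with t ht
    rw [norm_mul, Complex.norm_real]
    gcongr
  have hdiff : ∀ p ∈ Λ, Tendsto (fun t => (w t : ℂ) * summand p (Real.exp (-t)) -
      if lead p then (-1) ^ p.2 * l p * osc p t else 0) atTop (𝓝 0) := by
    intro p hp
    have hlp := (hl p hp).comp hx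
    by_cases hlead : lead p
    · have hz : Tendsto (fun t => ‖h p (Real.exp (-t)) - l p‖) atTop (𝓝 0) := by
        simpa using (hlp.sub_const (l p)).norm
      refine squeeze_zero_norm' ?_ hz
      filter_upwards [eventually_gt_atTop 0] with t ht
      rw [hsummand, if_pos hlead, hlead.1, hlead.2, sub_self, neg_zero, zero_mul, Real.exp_zero,
        one_mul, div_self (pow_ne_zero _ ht.ne'), Complex.ofReal_one, one_mul,
        show osc p t * ((-1) ^ m.2 * h p (Real.exp (-t))) - (-1) ^ m.2 * l p * osc p t =
          (-1) ^ m.2 * osc p t * (h p (Real.exp (-t)) - l p) by ring]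
      simp [hosc]
    · have hb : 0 < p.1.re - m.1.re ∨ p.1.re - m.1.re = 0 ∧ p.2 < m.2 := by
        rcases (hmin p hp).lt_or_eq with hlt | heq
        · exact Or.inl (sub_pos.mpr hlt)
        · exact Or.inr ⟨sub_eq_zero.mpr heq.symm,
            (hmax p hp heq.symm).lt_of_ne fun hj => hlead ⟨heq.symm, hj⟩⟩
      have hz := (tendsto_exp_neg_mul_pow_div_pow hb).norm.mul hlp.norm
      rw [norm_zero, zero_mul] at hz
      refine squeeze_zero_norm (fun t => ?_) hz
      rw [hsummand, if_neg hlead, sub_zero, norm_mul, Complex.norm_real]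
      simp [hosc]
  have hlim : Tendsto (fun t => ∑ p ∈ Λ.filter lead, (-1) ^ p.2 * l p * osc p t)
      atTop (𝓝 0) := by
    have hd := hsum.sub (tendsto_finsetSum Λ hdiff)
    simp only [Finset.sum_const_zero, sub_zero] at hd
    refine hd.congr fun t => ?_
    rw [Finset.sum_sub_distrib, ← Finset.mul_sum, sub_sub_cancel, Finset.sum_filter]
  have hzero := coeff_eq_zero_of_tendsto_sum_exp (Λ.filter lead) (fun p => -p.1.im)
    (fun p hp p' hp' him => by
      have h1 := (Finset.mem_filter.mp hp).2
      have h2 := (Finset.mem_filter.mp hp').2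
      exact Prod.ext (Complex.ext (h1.1.trans h2.1.symm) (neg_injective him))
        (h1.2.trans h2.2.symm))
    (fun p => (-1) ^ p.2 * l p) hlim m (Finset.mem_filter.mpr ⟨hmΛ, rfl, rfl⟩)
  exact hl0 m hmΛ ((mul_eq_zero.mp hzero).resolve_left (by simp))

/-- If `Λ` is a finite nonempty set of pairs `(λ,j)`, the coefficient functions `h_{λ,j}` are
analytic on `(-ε,ε)` with `h_{λ,j}(0) ≠ 0`, and the minimum of the real parts of the exponents is
negative, then `G(x) = Σ x^λ (log x)^j h_{λ,j}(x)` satisfies `limsup_{x→0+} |G(x)| = ∞`;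
in particular `G` does not extend continuously to `[0,ε)`. -/
theorem limsup_at_zero_of_negative_exponent
    (ε : ℝ) (hε : 0 < ε)
    (Λ : Finset (ℂ × ℕ)) (hΛ : Λ.Nonempty)
    (h : ℂ × ℕ → ℝ → ℂ)
    (hha : ∀ p ∈ Λ, AnalyticOnNhd ℝ (h p) (Ioo (-ε) ε))
    (hh0 : ∀ p ∈ Λ, h p 0 ≠ 0)
    (hneg : (Λ.image fun p => p.1.re).min' (hΛ.image _) < 0) :
    Filter.limsup
        (fun x : ℝ =>
          ((‖∑ p ∈ Λ, (x : ℂ) ^ p.1 * (Real.log x : ℂ) ^ p.2 * h p x‖ : ℝ) : EReal))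
        (nhdsWithin (0 : ℝ) (Ioi 0)) = ⊤ ∧
      ¬ ∃ G' : ℝ → ℂ, ContinuousOn G' (Ico 0 ε) ∧
        ∀ x ∈ Ioo (0 : ℝ) ε,
          G' x = ∑ p ∈ Λ, (x : ℂ) ^ p.1 * (Real.log x : ℂ) ^ p.2 * h p x := by
  have hexp : ∃ p ∈ Λ, p.1.re < 0 := by
    obtain ⟨p, hp, hpe⟩ := Finset.mem_image.mp (Finset.min'_mem _ (hΛ.image fun p => p.1.re))
    exact ⟨p, hp, hpe.trans_lt hneg⟩
  have hunb := not_eventually_norm_sum_cpow_mul_log_pow_le Λ h (fun p => h p 0)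
    (fun p hp => ((hha p hp 0 ⟨neg_lt_zero.mpr hε, hε⟩).continuousAt.tendsto).mono_left
      nhdsWithin_le_nhds)
    hh0 hexp
  constructor
  · by_contra hne
    obtain ⟨C, hC, -⟩ := EReal.lt_iff_exists_real_btwn.mp (lt_top_iff_ne_top.mpr hne)
    refine hunb C ((Filter.eventually_lt_of_limsup_lt hC).mono fun x hx => ?_)
    exact (EReal.coe_lt_coe_iff.mp hx).le
  · rintro ⟨G', hG', hGeq⟩
    have hc : Tendsto G' (𝓝[>] 0) (𝓝 (G' 0)) := by
      rw [← nhdsWithin_Ioo_eq_nhdsGT hε]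
      exact (hG' 0 ⟨le_rfl, hε⟩).mono Ioo_subset_Ico_self
    refine hunb (‖G' 0‖ + 1) ?_
    filter_upwards [hc.norm.eventually_le_const (lt_add_one _), Ioo_mem_nhdsGT hε] with x hx hxε
    rwa [← hGeq x hxε]
end

section
/- Let ε > 0, let N be a positive integer, and let B : D_ε → Mat(N×N, ℂ) be holomorphic. Suppose Ψ : (−ε,ε) → ℂ^N is C^∞ and satisfies the first-order linear system with a regular singular point Ψ′(x) = x^{−1}·B(x)·Ψ(x) for every x ∈ (−ε,ε) with x ≠ 0. Then Ψ is real-analytic on (−ε,ε) and extends to a holomorphic function on D_ε: there exists a holomorphic Ψ̃ : D_ε → ℂ^N with Ψ̃(x) = Ψ(x) for all x ∈ (−ε,ε). -/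
set_option autoImplicit false

open Set

/-- At the origin, the Euler operator `x d/dx` multiplies the `n`-th derivative by `n`. -/
theorem iteratedDeriv_smul_deriv_zero {𝕜 F : Type*} [NontriviallyNormedField 𝕜]
    [NormedAddCommGroup F] [NormedSpace 𝕜 F] {f : 𝕜 → F} (hf : ContDiffAt 𝕜 (⊤ : ℕ∞) f 0) (n : ℕ) :
    iteratedDeriv n (fun x => x • deriv f x) 0 = n • iteratedDeriv n f 0 := by
  have hd : ContDiffAt 𝕜 n (deriv f) 0 :=
    (hf.fderiv_right (m := n) (by exact_mod_cast le_top)).clm_apply contDiffAt_const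
  have key := iteratedDerivWithin_smul (n := n) (mem_univ (0 : 𝕜)) uniqueDiffOn_univ
    (contDiffAt_id (𝕜 := 𝕜) (n := n)).contDiffWithinAt hd.contDiffWithinAt
  simp only [iteratedDerivWithin_univ] at key
  refine key.trans ?_
  cases n with
  | zero => simp
  | succ m =>
    rw [Finset.sum_eq_single 1]
    · simp [iteratedDeriv_succ']
    · intro k _ hk
      have : iteratedDeriv k (id : 𝕜 → 𝕜) 0 = 0 := by
        rw [iteratedDeriv_id]; simp [hk]
      simp [this]
    · intro h; simp at h

/-- The real iterated derivatives of the restriction of a holomorphic function to the real line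
are its complex iterated derivatives. -/
theorem iteratedDeriv_comp_ofReal {f : ℂ → ℂ} {s : Set ℂ} (hs : IsOpen s)
    (hf : DifferentiableOn ℂ f s) (n : ℕ) {x : ℝ} (hx : (x : ℂ) ∈ s) :
    iteratedDeriv n (fun t : ℝ => f t) x = iteratedDeriv n f x := by
  induction n generalizing x with
  | zero => simp
  | succ n ih =>
    have hev : iteratedDeriv n (fun t : ℝ => f t) =ᶠ[nhds x] fun t : ℝ => iteratedDeriv n f t := by
      filter_upwards [(hs.preimage Complex.continuous_ofReal).mem_nhds hx] with t ht using ih ht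
    rw [iteratedDeriv_succ, iteratedDeriv_succ, hev.deriv_eq]
    have hd : DifferentiableAt ℂ (iteratedDeriv n f) x := by
      have := (hf.analyticAt (hs.mem_nhds hx)).iterated_deriv n
      rw [iteratedDeriv_eq_iterate]
      exact this.differentiableAt
    exact hd.hasDerivAt.comp_ofReal.deriv

/-- A nonnegative sequence with `n aₙ ≤ L (a₀ + ⋯ + aₙ)` grows subexponentially. -/
theorem exists_le_mul_pow_of_mul_le_sum {a : ℕ → ℝ} (ha : ∀ n, 0 ≤ a n) {L : ℝ}
    (h : ∀ n : ℕ, n * a n ≤ L * ∑ k ∈ Finset.range (n + 1), a k) {q : ℝ} (hq : 1 < q) :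
    ∃ C, ∀ n, a n ≤ C * q ^ n := by
  obtain ⟨m, hm⟩ := exists_nat_gt (L * q / (q - 1))
  have hq0 : 0 < q - 1 := by linarith
  rw [div_lt_iff₀ hq0] at hm
  set S : ℕ → ℝ := fun n => ∑ k ∈ Finset.range (n + 1), a k with hS
  have hS0 : ∀ n, 0 ≤ S n := fun n => Finset.sum_nonneg fun k _ => ha k
  have hmono : Monotone S := fun i j hij =>
    Finset.sum_le_sum_of_subset_of_nonneg (by simpa using hij) fun k _ _ => ha k
  have hsucc : ∀ n, S (n + 1) = S n + a (n + 1) := fun n => Finset.sum_range_succ _ _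
  have hbd : ∀ n, S n ≤ S m * q ^ n := by
    intro n
    induction n with
    | zero => simpa using hmono (Nat.zero_le m)
    | succ n ih =>
      rcases le_total (n + 1) m with hnm | hnm
      · exact (hmono hnm).trans (le_mul_of_one_le_right (hS0 m) (one_le_pow₀ hq.le))
      · have h1 := h (n + 1)
        have h2 : (m : ℝ) ≤ (n + 1 : ℕ) := by exact_mod_cast hnm
        have hsn := hsucc n
        change _ ≤ L * S (n + 1) at h1
        have hpos : (0 : ℝ) < (n + 1 : ℕ) := by positivity
        have h4 : ((n + 1 : ℕ) : ℝ) ≤ ((n + 1 : ℕ) - L) * q := by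
          nlinarith [mul_le_mul_of_nonneg_right h2 hq0.le]
        have h3 : 0 < ((n + 1 : ℕ) : ℝ) - L := by
          by_contra! hneg
          nlinarith
        have h5 : S (n + 1) ≤ q * S n := by
          refine le_of_mul_le_mul_left ?_ h3
          calc (((n + 1 : ℕ) : ℝ) - L) * S (n + 1) ≤ (n + 1 : ℕ) * S n := by
                rw [hsn] at h1 ⊢; linarith
            _ ≤ (((n + 1 : ℕ) - L) * q) * S n := mul_le_mul_of_nonneg_right h4 (hS0 n)
            _ = _ := by ring
        calc S (n + 1) ≤ q * S n := h5
          _ ≤ q * (S m * q ^ n) := by gcongr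
          _ = _ := by ring
  exact ⟨S m, fun n => (Finset.single_le_sum (f := a) (fun k _ => ha k)
    (Finset.self_mem_range_succ n)).trans (hbd n)⟩

/-- The entries of a holomorphic matrix are uniformly bounded on smaller closed discs. -/
theorem exists_entry_bound {ι : Type*} [Fintype ι] {ε : ℝ} {B : ℂ → Matrix ι ι ℂ}
    (hB : ∀ i j, DifferentiableOn ℂ (fun z => B z i j) (Metric.ball (0 : ℂ) ε))
    {r : ℝ} (hr : r < ε) :
    ∃ M, 0 ≤ M ∧ ∀ i j, ∀ z ∈ Metric.closedBall (0 : ℂ) r, ‖B z i j‖ ≤ M := by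
  have hM : ∀ i j, ∃ M, ∀ z ∈ Metric.closedBall (0 : ℂ) r, ‖B z i j‖ ≤ M := fun i j =>
    (isCompact_closedBall 0 r).exists_bound_of_continuousOn
      ((hB i j).continuousOn.mono (Metric.closedBall_subset_ball hr))
  choose M hM using hM
  refine ⟨∑ i, ∑ j, |M i j|, Finset.sum_nonneg fun i _ => Finset.sum_nonneg fun j _ =>
    abs_nonneg _, fun i j z hz => (hM i j z hz).trans <| (le_abs_self _).trans ?_⟩
  refine (Finset.single_le_sum (f := fun j => |M i j|) (fun _ _ => abs_nonneg _)
    (Finset.mem_univ j)).trans ?_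
  exact Finset.single_le_sum (f := fun i => ∑ j, |M i j|)
    (fun _ _ => Finset.sum_nonneg fun _ _ => abs_nonneg _) (Finset.mem_univ i)

/-- Derivatives at the origin of the formal solutions of `z Y' = B Y`, with `B` holomorphic on the
disc of radius `ε`, satisfy Cauchy estimates for every radius less than `ε`. -/
theorem formal_solution_bound {ι : Type*} [Fintype ι] {ε : ℝ} {B : ℂ → Matrix ι ι ℂ}
    (hB : ∀ i j, DifferentiableOn ℂ (fun z => B z i j) (Metric.ball (0 : ℂ) ε))
    {c : ℕ → ι → ℂ}
    (hc : ∀ n i, n * c n i = ∑ j, ∑ k ∈ Finset.range (n + 1),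
      n.choose k * iteratedDeriv k (fun z => B z i j) 0 * c (n - k) j)
    {ρ : ℝ} (hρ : 0 < ρ) (hρε : ρ < ε) :
    ∃ C, ∀ n i, ‖c n i‖ / n.factorial * ρ ^ n ≤ C := by
  obtain ⟨r, hρr, hrε⟩ := exists_between hρε
  have hr : 0 < r := hρ.trans hρr
  obtain ⟨M, hM0, hM⟩ := exists_entry_bound hB hrε
  have hcauchy : ∀ k i j, ‖iteratedDeriv k (fun z => B z i j) 0‖ ≤ k.factorial * M / r ^ k := by
    intro k i j
    refine Complex.norm_iteratedDeriv_le_of_forall_mem_sphere_norm_le k hr ?_ ?_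
    · exact ((hB i j).mono (Metric.closure_ball_subset_closedBall.trans
        (Metric.closedBall_subset_ball hrε))).diffContOnCl
    · intro z hz
      exact hM i j z (Metric.sphere_subset_closedBall hz)
  set a : ℕ → ℝ := fun n => ∑ i, ‖c n i‖ / n.factorial * r ^ n with ha_def
  have ha : ∀ n, 0 ≤ a n := fun n => Finset.sum_nonneg fun i _ => by positivity
  have hrec : ∀ n : ℕ, n * a n ≤ (Fintype.card ι * M) * ∑ k ∈ Finset.range (n + 1), a k := by
    intro n
    have hi : ∀ i, n * (‖c n i‖ / n.factorial * r ^ n) ≤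
        M * ∑ k ∈ Finset.range (n + 1), a k := by
      intro i
      have h1 : n * ‖c n i‖ ≤ ∑ j, ∑ k ∈ Finset.range (n + 1),
          n.choose k * (k.factorial * M / r ^ k) * ‖c (n - k) j‖ := by
        have := congrArg norm (hc n i)
        rw [norm_mul, Complex.norm_natCast] at this
        rw [this]
        refine norm_sum_le_of_le _ fun j _ => norm_sum_le_of_le _ fun k _ => ?_
        rw [norm_mul, norm_mul, Complex.norm_natCast]
        gcongr
        exact hcauchy k i j
      calc n * (‖c n i‖ / n.factorial * r ^ n)
          = (n * ‖c n i‖) * (r ^ n / n.factorial) := by ring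
        _ ≤ (∑ j, ∑ k ∈ Finset.range (n + 1),
          n.choose k * (k.factorial * M / r ^ k) * ‖c (n - k) j‖) * (r ^ n / n.factorial) := by
            gcongr
        _ = M * ∑ k ∈ Finset.range (n + 1), a (n - k) := by
            rw [Finset.sum_comm, Finset.sum_mul, Finset.mul_sum]
            refine Finset.sum_congr rfl fun k hk => ?_
            simp only [ha_def, Finset.sum_mul, Finset.mul_sum]
            refine Finset.sum_congr rfl fun j _ => ?_
            have hkn : k ≤ n := Nat.lt_succ_iff.mp (Finset.mem_range.mp hk)
            rw [Nat.cast_choose ℝ hkn]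
            have e : r ^ n = r ^ (n - k) * r ^ k := by rw [← pow_add, Nat.sub_add_cancel hkn]
            have := Nat.factorial_ne_zero
            rw [e]
            field_simp
        _ = M * ∑ k ∈ Finset.range (n + 1), a k := by
            rw [← Finset.sum_range_reflect a]
            simp
    calc n * a n = ∑ i, n * (‖c n i‖ / n.factorial * r ^ n) := by rw [ha_def, Finset.mul_sum]
      _ ≤ ∑ _i : ι, M * ∑ k ∈ Finset.range (n + 1), a k := Finset.sum_le_sum fun i _ => hi i
      _ = _ := by simp [mul_assoc]
  obtain ⟨C, hC⟩ := exists_le_mul_pow_of_mul_le_sum ha hrec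
    ((one_lt_div hρ).mpr hρr)
  refine ⟨C, fun n i => ?_⟩
  have h1 : ‖c n i‖ / n.factorial * r ^ n ≤ C * (r / ρ) ^ n :=
    (Finset.single_le_sum (f := fun i => ‖c n i‖ / n.factorial * r ^ n)
      (fun _ _ => by positivity) (Finset.mem_univ i)).trans (hC n)
  rw [div_pow, mul_div_assoc', le_div_iff₀ (by positivity), mul_right_comm] at h1
  exact le_of_mul_le_mul_right h1 (by positivity)

/-- Coefficients satisfying Cauchy estimates on all smaller discs are the derivatives at the origin
of a holomorphic function on the disc. -/
theorem exists_differentiableOn_iteratedDeriv_eq {ε : ℝ} (hε : 0 < ε) {c : ℕ → ℂ}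
    (hc : ∀ ρ, 0 < ρ → ρ < ε → ∃ C, ∀ n, ‖c n‖ / n.factorial * ρ ^ n ≤ C) :
    ∃ f : ℂ → ℂ, DifferentiableOn ℂ f (Metric.ball 0 ε) ∧ ∀ n, iteratedDeriv n f 0 = c n := by
  set p := FormalMultilinearSeries.ofScalars ℂ fun n => c n / n.factorial with hp
  have hrad : ENNReal.ofReal ε ≤ p.radius := by
    refine ENNReal.le_of_forall_nnreal_lt fun r hr => ?_
    rcases eq_or_ne r 0 with rfl | hr0
    · simp
    · have hrε : (r : ℝ) < ε := by
        rwa [← ENNReal.ofReal_coe_nnreal, ENNReal.ofReal_lt_ofReal_iff hε] at hr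
      obtain ⟨C, hC⟩ := hc r (by positivity) hrε
      refine p.le_radius_of_bound C fun n => ?_
      rw [hp, FormalMultilinearSeries.ofScalars_norm]
      simpa using hC n
  have hpos : 0 < ENNReal.ofReal ε := ENNReal.ofReal_pos.mpr hε
  have hf := (p.hasFPowerSeriesOnBall (hpos.trans_le hrad)).mono hpos hrad
  refine ⟨p.sum, ?_, fun n => ?_⟩
  · have := hf.differentiableOn
    rwa [Metric.eball_ofReal] at this
  · have := hf.factorial_smul (y := 1) n
    rw [iteratedDeriv_eq_iteratedFDeriv, ← this, hp, FormalMultilinearSeries.ofScalars_apply_eq]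
    have := Nat.factorial_ne_zero n
    simp
    field_simp

/-- Leibniz' rule for the product of a matrix and a vector. -/
theorem iteratedDeriv_sum_mul {𝕜 ι : Type*} [Fintype ι] [NontriviallyNormedField 𝕜]
    [NormedAlgebra 𝕜 ℂ] {b f : ι → 𝕜 → ℂ} {x : 𝕜} {n : ℕ}
    (hb : ∀ j, ContDiffAt 𝕜 n (b j) x) (hf : ∀ j, ContDiffAt 𝕜 n (f j) x) :
    iteratedDeriv n (fun z => ∑ j, b j z * f j z) x = ∑ j, ∑ k ∈ Finset.range (n + 1),
      n.choose k * iteratedDeriv k (b j) x * iteratedDeriv (n - k) (f j) x := by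
  rw [iteratedDeriv_fun_sum fun j _ => (hb j).mul (hf j)]
  exact Finset.sum_congr rfl fun j _ => iteratedDeriv_fun_mul (hb j) (hf j)

/-- Holomorphic functions whose derivatives at the origin formally solve `z Y' = B Y` solve it on
the disc. -/
theorem smul_deriv_eq_of_formal_solution {ι : Type*} [Fintype ι] {ε : ℝ} (hε : 0 < ε)
    {B : ℂ → Matrix ι ι ℂ}
    (hB : ∀ i j, DifferentiableOn ℂ (fun z => B z i j) (Metric.ball (0 : ℂ) ε))
    {f : ι → ℂ → ℂ} (hf : ∀ i, DifferentiableOn ℂ (f i) (Metric.ball 0 ε))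
    (hc : ∀ (n : ℕ) i, n * iteratedDeriv n (f i) 0 = ∑ j, ∑ k ∈ Finset.range (n + 1),
      n.choose k * iteratedDeriv k (fun z => B z i j) 0 * iteratedDeriv (n - k) (f j) 0)
    (i : ι) {z : ℂ} (hz : z ∈ Metric.ball (0 : ℂ) ε) :
    z • deriv (f i) z = ∑ j, B z i j * f j z := by
  have hnhds := Metric.ball_mem_nhds (0 : ℂ) hε
  have hfa : ∀ i, AnalyticAt ℂ (f i) 0 := fun i => (hf i).analyticAt hnhds
  have hBa : ∀ i j, AnalyticAt ℂ (fun z => B z i j) 0 := fun i j => (hB i j).analyticAt hnhds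
  set g : ℂ → ℂ := (fun z => z • deriv (f i) z) - fun z => ∑ j, B z i j * f j z with hg
  have hgd : DifferentiableOn ℂ g (Metric.ball 0 ε) :=
    (differentiableOn_id.smul ((hf i).deriv Metric.isOpen_ball)).sub
      (DifferentiableOn.fun_sum fun j _ => (hB i j).mul (hf j))
  have hzero : ∀ n, iteratedDeriv n g 0 = 0 := fun n => by
    rw [hg, iteratedDeriv_sub, iteratedDeriv_smul_deriv_zero (hfa i).contDiffAt,
      iteratedDeriv_sum_mul (fun j => (hBa i j).contDiffAt) (fun j => (hfa j).contDiffAt), ← hc,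
      nsmul_eq_mul, sub_self]
    · exact contDiffAt_id.smul (hfa i).deriv.contDiffAt
    · exact ContDiffAt.sum fun j _ => (hBa i j).contDiffAt.mul (hfa j).contDiffAt
  have := Complex.hasSum_taylorSeries_on_ball hgd hz
  simp only [hzero, smul_zero] at this
  exact sub_eq_zero.mp (this.unique hasSum_zero)

/-- A function that is flat at the origin and solves `x Φ' = B Φ` away from the origin,
with `B` bounded, vanishes. -/
theorem eq_zero_of_flat_of_regular_singular {E : Type*} [NormedAddCommGroup E] [NormedSpace ℝ E]
    {Φ Φ' : ℝ → E} {K x : ℝ} {m : ℕ} (hKm : K < m)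
    (hd : ∀ t ∈ Ioc (0 : ℝ) 1, HasDerivAt Φ (Φ' (t * x)) (t * x))
    (hbd : ∀ t ∈ Ioc (0 : ℝ) 1, ‖(t * x) • Φ' (t * x)‖ ≤ K * ‖Φ (t * x)‖)
    (hflat : Φ =O[nhds 0] fun t => t ^ m) : Φ x = 0 := by
  obtain ⟨C, hC⟩ := hflat.bound
  have hlim : Filter.Tendsto (fun T : ℝ => Real.exp (-T) * x) Filter.atTop (nhds 0) := by
    simpa using (Real.tendsto_exp_neg_atTop_nhds_zero).mul_const x
  have hexp : ∀ T : ℝ, 0 ≤ T → Real.exp (-T) ∈ Ioc (0 : ℝ) 1 := fun T hT =>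
    ⟨Real.exp_pos _, by simpa using hT⟩
  have hgr : ∀ T : ℝ, 0 ≤ T → ‖Φ x‖ ≤ ‖Φ (Real.exp (-T) * x)‖ * Real.exp (K * T) := by
    intro T hT
    have hmem : ∀ t ≤ T, Real.exp (t - T) ∈ Ioc (0 : ℝ) 1 := fun t ht => by
      simpa using hexp (T - t) (by linarith)
    have hder : ∀ t ≤ T, HasDerivAt (fun t => Φ (Real.exp (t - T) * x))
        ((Real.exp (t - T) * x) • Φ' (Real.exp (t - T) * x)) t := by
      intro t ht
      have h1 : HasDerivAt (fun t => Real.exp (t - T) * x) (Real.exp (t - T) * x) t := by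
        simpa using (((hasDerivAt_id t).sub_const T).exp).mul_const x
      exact (hd _ (hmem t ht)).scomp t h1
    have := norm_le_gronwallBound_of_norm_deriv_right_le (a := 0) (b := T) (K := K) (ε := 0)
      (fun t ht => (hder t ht.2).continuousAt.continuousWithinAt)
      (fun t ht => (hder t ht.2.le).hasDerivWithinAt) le_rfl
      (fun t ht => by simpa using hbd _ (hmem t ht.2.le)) T ⟨hT, le_rfl⟩
    simpa [gronwallBound_ε0] using this
  have hbound : ∀ᶠ T in Filter.atTop, ‖Φ x‖ ≤ C * |x| ^ m * Real.exp (-((m - K) * T)) := by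
    filter_upwards [hlim.eventually hC, Filter.eventually_ge_atTop 0] with T hCT hT
    calc ‖Φ x‖ ≤ ‖Φ (Real.exp (-T) * x)‖ * Real.exp (K * T) := hgr T hT
      _ ≤ (C * ‖(Real.exp (-T) * x) ^ m‖) * Real.exp (K * T) := by gcongr
      _ = C * |x| ^ m * (Real.exp (m * -T) * Real.exp (K * T)) := by
        rw [norm_pow, norm_mul, Real.norm_eq_abs, Real.norm_eq_abs, Real.abs_exp, mul_pow,
          Real.exp_nat_mul]
        ring
      _ = _ := by rw [← Real.exp_add]; ring_nf
  have hto : Filter.Tendsto (fun T : ℝ => C * |x| ^ m * Real.exp (-((m - K) * T)))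
      Filter.atTop (nhds 0) := by
    simpa using (Real.tendsto_exp_neg_atTop_nhds_zero.comp
      (Filter.tendsto_id.const_mul_atTop (sub_pos.mpr hKm))).const_mul (C * |x| ^ m)
  exact norm_le_zero_iff.mp (ge_of_tendsto hto hbound)

/-- A smooth function all of whose derivatives vanish at the origin is `O(x ^ m)` for all `m`. -/
theorem isBigO_pow_of_iteratedDeriv_eq_zero {E : Type*} [NormedAddCommGroup E] [NormedSpace ℝ E]
    {f : ℝ → E} {s : Set ℝ} (hs : IsOpen s) (hconv : Convex ℝ s) (h0 : (0 : ℝ) ∈ s)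
    (hf : ContDiffOn ℝ (⊤ : ℕ∞) f s) (hz : ∀ n, iteratedDeriv n f 0 = 0) (m : ℕ) :
    f =O[nhds 0] fun t => t ^ m := by
  have := taylor_isLittleO (n := m) hconv h0 (hf.of_le (by exact_mod_cast le_top))
  rw [hs.nhdsWithin_eq h0] at this
  simpa [taylor_within_apply, iteratedDerivWithin_of_isOpen hs h0, hz] using this.isBigO

/-- A `C^∞` solution on `(-ε,ε)` of a first-order linear system `Ψ′(x) = x⁻¹ B(x) Ψ(x)`
with a regular singular point at `0` (where `B` is holomorphic on the disc `D_ε`) is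
real-analytic on `(-ε,ε)` and extends to a holomorphic function on `D_ε`. -/
theorem smooth_solution_of_regular_singular_system_is_analytic
    (ε : ℝ) (hε : 0 < ε) (N : ℕ) (hN : 0 < N)
    (B : ℂ → Matrix (Fin N) (Fin N) ℂ)
    (hB : ∀ i j, DifferentiableOn ℂ (fun z => B z i j) (Metric.ball (0 : ℂ) ε))
    (Ψ : ℝ → Fin N → ℂ)
    (hΨ : ContDiffOn ℝ (⊤ : ℕ∞) Ψ (Ioo (-ε) ε))
    (hode : ∀ x ∈ Ioo (-ε) ε, x ≠ 0 →
      HasDerivAt Ψ ((x : ℂ)⁻¹ • (B (x : ℂ)).mulVec (Ψ x)) x) :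
    AnalyticOnNhd ℝ Ψ (Ioo (-ε) ε) ∧
      ∃ Ψt : ℂ → Fin N → ℂ,
        (∀ i, DifferentiableOn ℂ (fun z => Ψt z i) (Metric.ball (0 : ℂ) ε)) ∧
        ∀ x ∈ Ioo (-ε) ε, Ψt (x : ℂ) = Ψ x := by
  have hball : ∀ {x : ℝ}, x ∈ Ioo (-ε) ε → (x : ℂ) ∈ Metric.ball (0 : ℂ) ε := fun {x} hx => by
    simpa [abs_lt] using hx
  have h0 : (0 : ℝ) ∈ Ioo (-ε) ε := ⟨by linarith, hε⟩
  have hnhds : Ioo (-ε) ε ∈ nhds (0 : ℝ) := isOpen_Ioo.mem_nhds h0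
  have hψ : ∀ i, ContDiffOn ℝ (⊤ : ℕ∞) (fun x => Ψ x i) (Ioo (-ε) ε) := contDiffOn_pi.mp hΨ
  have hψ0 : ∀ i, ContDiffAt ℝ (⊤ : ℕ∞) (fun x => Ψ x i) 0 := fun i => (hψ i).contDiffAt hnhds
  have hreal : ∀ {f : ℂ → ℂ}, DifferentiableOn ℂ f (Metric.ball 0 ε) →
      ContDiffOn ℝ (⊤ : ℕ∞) (fun x : ℝ => f x) (Ioo (-ε) ε) := fun {f} hf x hx =>
    (((hf.analyticAt (Metric.isOpen_ball.mem_nhds (hball hx))).contDiffAt.restrict_scalars ℝ).comp x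
      Complex.ofRealCLM.contDiff.contDiffAt).contDiffWithinAt
  have hB0 : ∀ i j, ContDiffAt ℝ (⊤ : ℕ∞) (fun x : ℝ => B x i j) 0 := fun i j =>
    (hreal (hB i j)).contDiffAt hnhds
  have hodei : ∀ i, ∀ x ∈ Ioo (-ε) ε, x ≠ 0 →
      HasDerivAt (fun x => Ψ x i) ((x : ℂ)⁻¹ * ∑ j, B x i j * Ψ x j) x := fun i x hx hx0 => by
    simpa [Matrix.mulVec, dotProduct] using hasDerivAt_pi.mp (hode x hx hx0) i
  have heuler : ∀ i, (fun x : ℝ => x • deriv (fun x => Ψ x i) x) =ᶠ[nhds 0]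
      fun x => ∑ j, B x i j * Ψ x j := by
    intro i
    have hne : (fun x : ℝ => x • deriv (fun x => Ψ x i) x) =ᶠ[nhdsWithin 0 {0}ᶜ]
        fun x => ∑ j, B x i j * Ψ x j := by
      filter_upwards [self_mem_nhdsWithin, mem_nhdsWithin_of_mem_nhds hnhds] with x hx0 hx
      rw [(hodei i x hx hx0).deriv, Complex.real_smul, mul_inv_cancel_left₀]
      exact_mod_cast hx0
    have hc1 : ContinuousAt (fun x : ℝ => x • deriv (fun x => Ψ x i) x) 0 := by
      have : ContinuousAt (deriv fun x => Ψ x i) 0 :=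
        ((hψ0 i).continuousAt_fderiv (by simp)).clm_apply continuousAt_const
      exact continuousAt_id.smul this
    have hc2 : ContinuousAt (fun x : ℝ => ∑ j, B x i j * Ψ x j) 0 :=
      (ContDiffAt.sum (n := (⊤ : ℕ∞)) fun j _ => (hB0 i j).mul (hψ0 j)).continuousAt
    exact (hc1.eventuallyEq_nhds_iff_eventuallyEq_nhdsNE hc2).mp hne
  have hc : ∀ (n : ℕ) i, n * iteratedDeriv n (fun x => Ψ x i) 0 =
      ∑ j, ∑ k ∈ Finset.range (n + 1), n.choose k * iteratedDeriv k (fun z => B z i j) 0 *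
        iteratedDeriv (n - k) (fun x => Ψ x j) 0 := by
    intro n i
    have hn : ((n : ℕ∞) : WithTop ℕ∞) ≤ (⊤ : ℕ∞) := by exact_mod_cast le_top
    have := (heuler i).iteratedDeriv_eq n
    rw [iteratedDeriv_smul_deriv_zero (hψ0 i), nsmul_eq_mul, iteratedDeriv_sum_mul
      (fun j => (hB0 i j).of_le hn) (fun j => (hψ0 j).of_le hn)] at this
    rw [this]
    refine Finset.sum_congr rfl fun j _ => Finset.sum_congr rfl fun k _ => ?_
    rw [iteratedDeriv_comp_ofReal Metric.isOpen_ball (hB i j) k (hball h0), Complex.ofReal_zero]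
  have hex : ∀ i, ∃ f : ℂ → ℂ, DifferentiableOn ℂ f (Metric.ball 0 ε) ∧
      ∀ n, iteratedDeriv n f 0 = iteratedDeriv n (fun x => Ψ x i) 0 := fun i =>
    exists_differentiableOn_iteratedDeriv_eq hε fun ρ hρ hρε => by
      obtain ⟨C, hC⟩ := formal_solution_bound (c := fun n i => iteratedDeriv n (fun x => Ψ x i) 0)
        hB hc hρ hρε
      exact ⟨C, fun n => hC n i⟩
  choose f hf hfΨ using hex
  have hfode := smul_deriv_eq_of_formal_solution hε hB hf (by simpa only [hfΨ] using hc)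
  have hext : ∀ x ∈ Ioo (-ε) ε, (fun i => f i x) = Ψ x := by
    intro x hx
    rcases eq_or_ne x 0 with rfl | hx0
    · ext i
      simpa using hfΨ i 0
    obtain ⟨M, hM0, hM⟩ := exists_entry_bound hB (abs_lt.mpr hx)
    obtain ⟨m, hm⟩ := exists_nat_gt (N * M)
    set Φ : ℝ → Fin N → ℂ := fun y i => Ψ y i - f i y with hΦ
    have hflat : Φ =O[nhds 0] fun t => t ^ m := by
      refine Asymptotics.isBigO_pi.mpr fun i => ?_
      refine isBigO_pow_of_iteratedDeriv_eq_zero isOpen_Ioo (convex_Ioo _ _) h0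
        ((hψ i).sub (hreal (hf i))) (fun n => ?_) m
      have hn : ((n : ℕ∞) : WithTop ℕ∞) ≤ (⊤ : ℕ∞) := by exact_mod_cast le_top
      refine (iteratedDeriv_fun_sub ((hψ0 i).of_le hn)
        (((hreal (hf i)).contDiffAt hnhds).of_le hn)).trans ?_
      rw [iteratedDeriv_comp_ofReal Metric.isOpen_ball (hf i) n (hball h0), Complex.ofReal_zero,
        hfΨ, sub_self]
    have hseg : ∀ t ∈ Ioc (0 : ℝ) 1, t * x ∈ Ioo (-ε) ε ∧ t * x ≠ 0 ∧ |t * x| ≤ |x| := by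
      intro t ht
      have hle : |t * x| ≤ |x| := by
        rw [abs_mul, abs_of_pos ht.1]
        exact mul_le_of_le_one_left (abs_nonneg x) ht.2
      exact ⟨abs_lt.mp (hle.trans_lt (abs_lt.mpr hx)), mul_ne_zero ht.1.ne' hx0, hle⟩
    have hΦx : Φ x = 0 := by
      refine eq_zero_of_flat_of_regular_singular
        (Φ' := fun y i => (y : ℂ)⁻¹ * ∑ j, B y i j * Φ y j) hm (fun t ht => ?_) (fun t ht => ?_)
        hflat
      · obtain ⟨hy, hy0, -⟩ := hseg t ht
        generalize t * x = y at hy hy0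
        have hy0' : (y : ℂ) ≠ 0 := by exact_mod_cast hy0
        refine hasDerivAt_pi.mpr fun i => ?_
        have hfd : HasDerivAt (f i) ((y : ℂ)⁻¹ * ∑ j, B y i j * f j y) y := by
          rw [← hfode i (hball hy), smul_eq_mul, inv_mul_cancel_left₀ hy0']
          exact ((hf i).differentiableAt (Metric.isOpen_ball.mem_nhds (hball hy))).hasDerivAt
        refine ((hodei i y hy hy0).fun_sub hfd.comp_ofReal).congr_deriv ?_
        simp only [hΦ, mul_sub, Finset.sum_sub_distrib]
      · obtain ⟨hy, hy0, hyx⟩ := hseg t ht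
        generalize t * x = y at hy hy0 hyx
        have hy0' : (y : ℂ) ≠ 0 := by exact_mod_cast hy0
        refine (pi_norm_le_iff_of_nonneg (by positivity)).mpr fun i => ?_
        rw [Pi.smul_apply, Complex.real_smul, mul_inv_cancel_left₀ hy0']
        calc ‖∑ j, B y i j * Φ y j‖ ≤ ∑ _j : Fin N, M * ‖Φ y‖ :=
              norm_sum_le_of_le _ fun j _ => by
                rw [norm_mul]
                exact mul_le_mul (hM i j y (by simpa using hyx)) (norm_le_pi_norm _ j)
                  (norm_nonneg _) hM0
          _ = N * M * ‖Φ y‖ := by simp [mul_assoc]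
    ext i
    exact (sub_eq_zero.mp (congrFun hΦx i)).symm
  refine ⟨fun x hx => ?_, fun z i => f i z, hf, hext⟩
  have hana : AnalyticAt ℝ (fun (x : ℝ) i => f i x) x := by
    refine AnalyticAt.pi fun i => ?_
    exact (((hf i).analyticAt (Metric.isOpen_ball.mem_nhds (hball hx))).restrictScalars (𝕜 := ℝ)).comp
      (Complex.ofRealCLM.analyticAt x)
  refine hana.congr ?_
  filter_upwards [isOpen_Ioo.mem_nhds hx] with y hy using hext y hy
end

section
/- Let P be a homogeneous complex-valued polynomial function on E of degree d. Then in End_ℂ(C^∞(E,ℂ)) the identity (1/d!)·(ad(Δ/2))^d (M_P) = ∂(P) holds, where ad(A)B := A∘B − B∘A, M_P is multiplication by P, Δ is the Laplacian, and ∂(P) is the constant-coefficient differential operator associated to P. -/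
set_option autoImplicit false

noncomputable section

variable {E : Type*} [NormedAddCommGroup E] [InnerProductSpace ℝ E]

/-- The directional derivative `D_ξ` acting on complex-valued functions on `E`. -/
def dirDeriv (ξ : E) (f : E → ℂ) : E → ℂ := fun x => fderiv ℝ f x ξ

/-- The multiplication operator `M_P` by a function `P`. -/
def mulOp (P : E → ℂ) : (E → ℂ) → (E → ℂ) := fun f x => P x * f x

/-- Half the Laplacian `Δ/2 = (1/2) Σᵢ D_{eᵢ}²` computed in an orthonormal basis. -/
def lapHalf {n : ℕ} (b : OrthonormalBasis (Fin n) ℝ E) : (E → ℂ) → (E → ℂ) :=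
  fun f => (2 : ℂ)⁻¹ • ∑ i : Fin n, dirDeriv (b i) (dirDeriv (b i) f)

/-- The monomial constant-coefficient differential operator `∏ᵢ D_{bᵢ}^{mᵢ}`. -/
def monoDeriv {n : ℕ} (b : Fin n → E) (m : Fin n →₀ ℕ) : (E → ℂ) → (E → ℂ) :=
  (List.ofFn fun i : Fin n => (dirDeriv (b i))^[m i]).foldr (· ∘ ·) id

/-- The constant-coefficient differential operator `∂(p)` obtained from a polynomial `p`
by substituting the directional derivatives `D_{bᵢ}` for the coordinates. -/
def polyDeriv {n : ℕ} (b : Fin n → E) (p : MvPolynomial (Fin n) ℂ) (f : E → ℂ) : E → ℂ :=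
  fun x => ∑ m ∈ p.support, MvPolynomial.coeff m p * monoDeriv b m f x

/-- The polynomial function on `E` associated to `p` via the orthonormal coordinates of `b`. -/
def polyFun {n : ℕ} (b : OrthonormalBasis (Fin n) ℝ E) (p : MvPolynomial (Fin n) ℂ) : E → ℂ :=
  fun x => MvPolynomial.eval (fun i => (b.repr x i : ℂ)) p

end


noncomputable section AdjointPower

variable {A : Type*} [Ring A]

theorem commutator_mul (L x y : A) : ⁅L, x * y⁆ = ⁅L, x⁆ * y + x * ⁅L, y⁆ := by
  simp only [Ring.lie_def]; noncomm_ring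

theorem commutator_mul_self (D x : A) : ⁅D * D, x⁆ = D * ⁅D, x⁆ + ⁅D, x⁆ * D := by
  simp only [Ring.lie_def, mul_sub, sub_mul, mul_assoc]; abel

variable [Algebra ℂ A]

/-- The commutator map `ad L = [L, ·]` as a `ℂ`-linear endomorphism of `A`. -/
def adLeft (L : A) : Module.End ℂ A :=
  LinearMap.mulLeft ℂ L - LinearMap.mulRight ℂ L

theorem adLeft_apply (L x : A) : adLeft L x = ⁅L, x⁆ := rfl

theorem commutator_smul_sum {ι : Type*} (c : ℂ) (s : Finset ι) (a : ι → A) (x : A) :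
    ⁅c • ∑ i ∈ s, a i, x⁆ = c • ∑ i ∈ s, ⁅a i, x⁆ := by
  simp only [Ring.lie_def, Finset.sum_sub_distrib, smul_sub, Finset.sum_mul, Finset.mul_sum,
    smul_mul_assoc, mul_smul_comm]

/-- The Leibniz rule for powers of `ad L`, when the first factor is annihilated by `(ad L)²`. -/
theorem ad_pow_succ_mul (L x y W : A) (hx : ⁅L, x⁆ = y) (hy : ⁅L, y⁆ = 0) (k : ℕ) :
    (adLeft L ^ (k + 1)) (x * W) =
      x * (adLeft L ^ (k + 1)) W + (k + 1 : ℂ) • (y * (adLeft L ^ k) W) := by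
  have hs : ∀ j, ⁅L, (adLeft L ^ j) W⁆ = (adLeft L ^ (j + 1)) W := fun j => by
    rw [pow_succ', Module.End.mul_apply, adLeft_apply]
  induction k with
  | zero => simp [adLeft_apply, commutator_mul, hx, add_comm]
  | succ k ih =>
    rw [pow_succ' _ (k + 1), Module.End.mul_apply, ih, Module.End.mul_apply, map_add, map_smul]
    simp only [adLeft_apply, commutator_mul, hx, hy, zero_mul, zero_add]
    simp only [hs]
    push_cast
    module

/-- `V` is the normalized top iterate `(1/k!) (ad L)ᵏ W`, and it is annihilated by `ad L`. -/
def IsTopAd (L : A) (k : ℕ) (W V : A) : Prop :=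
  (adLeft L ^ k) W = (k.factorial : ℂ) • V ∧ ⁅L, V⁆ = 0

theorem IsTopAd.one (L : A) : IsTopAd L 0 1 1 := by
  simp [IsTopAd, Ring.lie_def]

theorem IsTopAd.mul_left {L x y W V : A} {k : ℕ} (hx : ⁅L, x⁆ = y) (hy : ⁅L, y⁆ = 0)
    (h : IsTopAd L k W V) : IsTopAd L (k + 1) (x * W) (y * V) := by
  obtain ⟨h1, h2⟩ := h
  constructor
  · rw [ad_pow_succ_mul L x y W hx hy, pow_succ', Module.End.mul_apply, h1, map_smul,
      adLeft_apply, h2, Nat.factorial_succ]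
    push_cast
    simp [smul_smul]
  · rw [commutator_mul, hy, h2]; simp

theorem IsTopAd.pow_mul_left {L x y W V : A} {k : ℕ} (hx : ⁅L, x⁆ = y) (hy : ⁅L, y⁆ = 0)
    (h : IsTopAd L k W V) (r : ℕ) : IsTopAd L (r + k) (x ^ r * W) (y ^ r * V) := by
  induction r with
  | zero => simpa using h
  | succ r ih =>
    rw [pow_succ', pow_succ', mul_assoc, mul_assoc, add_right_comm]
    exact ih.mul_left hx hy

theorem IsTopAd.prod_map_pow {ι : Type*} (L : A) (x y : ι → A) (hx : ∀ i, ⁅L, x i⁆ = y i)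
    (hy : ∀ i, ⁅L, y i⁆ = 0) (m : ι → ℕ) (l : List ι) :
    IsTopAd L (l.map m).sum (l.map fun i => x i ^ m i).prod (l.map fun i => y i ^ m i).prod := by
  induction l with
  | nil => exact IsTopAd.one L
  | cons i l ih =>
    simp only [List.map_cons, List.sum_cons, List.prod_cons]
    exact ih.pow_mul_left (hx i) (hy i) (m i)

end AdjointPower

noncomputable section SmoothOperators

open scoped ContDiff

variable {E : Type*} [NormedAddCommGroup E] [InnerProductSpace ℝ E]

variable (E) in
/-- The space `C^∞(E, ℂ)` as a complex subspace of all functions. -/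
def smoothFunctions : Submodule ℂ (E → ℂ) where
  carrier := {f | ContDiff ℝ ∞ f}
  add_mem' := fun {f g} (hf : ContDiff ℝ ∞ f) (hg : ContDiff ℝ ∞ g) => hf.add hg
  zero_mem' := (contDiff_const : ContDiff ℝ ∞ fun _ : E => (0 : ℂ))
  smul_mem' := fun c f (hf : ContDiff ℝ ∞ f) => hf.const_smul c

theorem contDiff_dirDeriv (ξ : E) {f : E → ℂ} (hf : ContDiff ℝ ∞ f) :
    ContDiff ℝ ∞ (dirDeriv ξ f) :=
  (hf.fderiv_right (m := ∞) le_rfl).clm_apply contDiff_const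

/-- The directional derivative as an endomorphism of `C^∞(E, ℂ)`. -/
def dirDerivEnd (ξ : E) : Module.End ℂ (smoothFunctions E) where
  toFun f := ⟨dirDeriv ξ f, contDiff_dirDeriv ξ f.2⟩
  map_add' f g := by
    ext x
    have hf := (show ContDiff ℝ ∞ f.1 from f.2).differentiable (by simp) x
    have hg := (show ContDiff ℝ ∞ g.1 from g.2).differentiable (by simp) x
    simp [dirDeriv, fderiv_add hf hg]
  map_smul' c f := by
    ext x
    have hf := (show ContDiff ℝ ∞ f.1 from f.2).differentiable (by simp) x
    simp [dirDeriv, fderiv_const_smul hf]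

theorem commute_dirDerivEnd (ξ η : E) : Commute (dirDerivEnd ξ) (dirDerivEnd η) := by
  ext f x
  have hf : ContDiff ℝ ∞ f.1 := f.2
  have key : ∀ v w : E, dirDeriv v (dirDeriv w f.1) x = fderiv ℝ (fderiv ℝ f.1) x v w := by
    intro v w
    have h : DifferentiableAt ℝ (fderiv ℝ f.1) x :=
      (hf.fderiv_right (m := ∞) le_rfl).differentiable (by simp) x
    change fderiv ℝ (fun y => fderiv ℝ f.1 y w) x v = _
    rw [fderiv_clm_apply h (differentiableAt_const w)]
    simp
  have hs : IsSymmSndFDerivAt ℝ f.1 x :=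
    hf.contDiffAt.isSymmSndFDerivAt (by simpa using WithTop.coe_le_coe.2 (le_top : (2 : ℕ∞) ≤ ⊤))
  change dirDeriv ξ (dirDeriv η f.1) x = dirDeriv η (dirDeriv ξ f.1) x
  rw [key, key, hs.eq]

variable {n : ℕ} (b : OrthonormalBasis (Fin n) ℝ E)

theorem contDiff_polyFun (p : MvPolynomial (Fin n) ℂ) : ContDiff ℝ ∞ (polyFun b p) := by
  have hcoord : ∀ i, ContDiff ℝ ∞ fun x => (b.repr x i : ℂ) := fun i => by
    simp only [b.repr_apply_apply]
    exact Complex.ofRealCLM.contDiff.comp (contDiff_const.inner ℝ contDiff_id)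
  induction p using MvPolynomial.induction_on with
  | C a => simpa +unfoldPartialApp [polyFun] using (contDiff_const : ContDiff ℝ ∞ fun _ : E => a)
  | add p q hp hq => simpa +unfoldPartialApp [polyFun] using hp.add hq
  | mul_X p i hp => simpa +unfoldPartialApp [polyFun] using hp.mul (hcoord i)

/-- Multiplication by polynomial functions, as an algebra homomorphism into the endomorphisms of
`C^∞(E, ℂ)`. -/
def polyMulEnd : MvPolynomial (Fin n) ℂ →ₐ[ℂ] Module.End ℂ (smoothFunctions E) where
  toFun p :=
    { toFun := fun f => ⟨mulOp (polyFun b p) f, (contDiff_polyFun b p).mul f.2⟩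
      map_add' := fun f g => by ext x; simp [mulOp, mul_add]
      map_smul' := fun c f => by ext x; simp [mulOp, mul_left_comm] }
  map_one' := by ext f x; simp [mulOp, polyFun]
  map_mul' p q := by ext f x; simp [mulOp, polyFun, mul_assoc]
  map_zero' := by ext f x; simp [mulOp, polyFun]
  map_add' p q := by ext f x; simp [mulOp, polyFun, add_mul]
  commutes' c := by ext f x; simp [mulOp, polyFun]

/-- Half the Laplacian as an endomorphism of `C^∞(E, ℂ)`. -/
def lapHalfEnd : Module.End ℂ (smoothFunctions E) :=
  (2 : ℂ)⁻¹ • ∑ i, dirDerivEnd (b i) * dirDerivEnd (b i)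

theorem coe_lapHalfEnd_apply (f : smoothFunctions E) :
    (lapHalfEnd b f : E → ℂ) = lapHalf b f := by
  simp [lapHalfEnd, lapHalf, LinearMap.sum_apply, dirDerivEnd]

theorem lie_dirDerivEnd_polyMulEnd_X (i j : Fin n) :
    ⁅dirDerivEnd (b i), polyMulEnd b (MvPolynomial.X j)⁆ = if i = j then 1 else 0 := by
  ext f x
  have hf := (show ContDiff ℝ ∞ f.1 from f.2).differentiable (by simp) x
  have hc : HasFDerivAt (fun y : E => (b.repr y j : ℂ))
      (Complex.ofRealCLM.comp (innerSL ℝ (b j))) x := by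
    simp only [b.repr_apply_apply]
    exact (Complex.ofRealCLM.comp (innerSL ℝ (b j))).hasFDerivAt
  have hfun : mulOp (polyFun b (MvPolynomial.X j)) f.1 = fun y => (b.repr y j : ℂ) * f.1 y := by
    ext y; simp [mulOp, polyFun]
  have hd : dirDeriv (b i) (mulOp (polyFun b (MvPolynomial.X j)) f.1) x =
      (b.repr x j : ℂ) * dirDeriv (b i) f.1 x + (if i = j then 1 else 0) * f.1 x := by
    rw [hfun, dirDeriv, fderiv_fun_mul hc.differentiableAt hf, hc.fderiv]
    simp [dirDeriv, orthonormal_iff_ite.mp b.orthonormal, eq_comm (a := j)]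
    split_ifs <;> simp
  change dirDeriv (b i) (mulOp (polyFun b (MvPolynomial.X j)) f.1) x -
    mulOp (polyFun b (MvPolynomial.X j)) (dirDeriv (b i) f.1) x = _
  rw [hd]
  split_ifs <;> simp [mulOp, polyFun]

theorem lie_lapHalfEnd_dirDerivEnd (ξ : E) : ⁅lapHalfEnd b, dirDerivEnd ξ⁆ = 0 := by
  rw [Ring.lie_def, sub_eq_zero]
  exact (Commute.sum_left _ _ _ fun i _ =>
    (commute_dirDerivEnd (b i) ξ).mul_left (commute_dirDerivEnd (b i) ξ)).smul_left _

theorem lie_lapHalfEnd_polyMulEnd_X (j : Fin n) :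
    ⁅lapHalfEnd b, polyMulEnd b (MvPolynomial.X j)⁆ = dirDerivEnd (b j) := by
  have h : ∀ i, ⁅dirDerivEnd (b i) * dirDerivEnd (b i), polyMulEnd b (MvPolynomial.X j)⁆ =
      if i = j then (2 : ℂ) • dirDerivEnd (b j) else 0 := fun i => by
    refine (commutator_mul_self (dirDerivEnd (b i)) (polyMulEnd b (MvPolynomial.X j))).trans ?_
    rw [lie_dirDerivEnd_polyMulEnd_X]
    split_ifs with hij
    · rw [hij, mul_one, one_mul, two_smul]
    · simp
  refine (commutator_smul_sum (2 : ℂ)⁻¹ Finset.univ (fun i => dirDerivEnd (b i) * dirDerivEnd (b i))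
    (polyMulEnd b (MvPolynomial.X j))).trans ?_
  simp_rw [h]
  simp [smul_smul]

theorem monomial_one_eq_prod_map (m : Fin n →₀ ℕ) :
    (MvPolynomial.monomial m (1 : ℂ)) =
      ((List.finRange n).map fun i => MvPolynomial.X i ^ m i).prod := by
  rw [MvPolynomial.monomial_eq, Finsupp.prod_fintype _ _ (by simp), ← List.ofFn_eq_map,
    List.prod_ofFn]
  simp

theorem coe_prod_map_dirDerivEnd_apply (m : Fin n →₀ ℕ) (f : smoothFunctions E) :
    ((((List.finRange n).map fun i => dirDerivEnd (b i) ^ m i).prod f : smoothFunctions E) : E → ℂ)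
      = monoDeriv (fun i => b i) m f := by
  have hpow : ∀ (ξ : E) (k : ℕ) (g : smoothFunctions E),
      (((dirDerivEnd ξ ^ k) g : smoothFunctions E) : E → ℂ) = (dirDeriv ξ)^[k] g := by
    intro ξ k g
    induction k with
    | zero => rfl
    | succ k ih => rw [pow_succ', Function.iterate_succ_apply', ← ih]; rfl
  rw [monoDeriv, List.ofFn_eq_map]
  induction List.finRange n with
  | nil => rfl
  | cons i l ih =>
    simp only [List.map_cons, List.prod_cons, List.foldr_cons, Function.comp_apply,
      Module.End.mul_apply, hpow, ih]

theorem isTopAd_monomial (m : Fin n →₀ ℕ) :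
    IsTopAd (lapHalfEnd b) m.degree (polyMulEnd b (MvPolynomial.monomial m 1))
      ((List.finRange n).map fun i => dirDerivEnd (b i) ^ m i).prod := by
  have h := IsTopAd.prod_map_pow (lapHalfEnd b) (fun j => polyMulEnd b (MvPolynomial.X j))
    (fun j => dirDerivEnd (b j)) (lie_lapHalfEnd_polyMulEnd_X b)
    (fun j => lie_lapHalfEnd_dirDerivEnd b (b j)) m (List.finRange n)
  rw [monomial_one_eq_prod_map, map_list_prod, List.map_map]
  have hdeg : ((List.finRange n).map m).sum = m.degree := by
    rw [Finsupp.degree_eq_sum, ← List.ofFn_eq_map, List.sum_ofFn]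
  rw [hdeg] at h
  simpa [Function.comp_def] using h

theorem coe_ad_pow_apply (T : Module.End ℂ (smoothFunctions E)) (B : (E → ℂ) → (E → ℂ))
    (h : ∀ f : smoothFunctions E, (T f : E → ℂ) = B f) (d : ℕ) (f : smoothFunctions E) :
    (((adLeft (lapHalfEnd b) ^ d) T f : smoothFunctions E) : E → ℂ) =
      (fun B : (E → ℂ) → (E → ℂ) => lapHalf b ∘ B - B ∘ lapHalf b)^[d] B f := by
  induction d generalizing f with
  | zero => exact h f
  | succ d ih =>
    rw [pow_succ', Function.iterate_succ_apply', Module.End.mul_apply, adLeft_apply,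
      Ring.lie_def]
    simp only [LinearMap.sub_apply, Module.End.mul_apply, Submodule.coe_sub, coe_lapHalfEnd_apply,
      ih, Pi.sub_apply, Function.comp_apply]

theorem ad_lapHalfEnd_pow_polyMulEnd {d : ℕ} {p : MvPolynomial (Fin n) ℂ}
    (hp : p.IsHomogeneous d) :
    (adLeft (lapHalfEnd b) ^ d) (polyMulEnd b p) =
      (d.factorial : ℂ) • ∑ m ∈ p.support, MvPolynomial.coeff m p •
        ((List.finRange n).map fun i => dirDerivEnd (b i) ^ m i).prod := by
  conv_lhs => rw [p.as_sum]
  rw [map_sum, map_sum, Finset.smul_sum]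
  refine Finset.sum_congr rfl fun m hm => ?_
  have hdeg : m.degree = d := by
    rw [Finsupp.degree_eq_weight_one]
    exact hp (MvPolynomial.mem_support_iff.mp hm)
  have h := (isTopAd_monomial b m).1
  rw [hdeg] at h
  rw [← mul_one (MvPolynomial.coeff m p), ← smul_eq_mul, ← MvPolynomial.smul_monomial, map_smul,
    map_smul, h, smul_comm, smul_eq_mul, mul_one]

end SmoothOperators

/-- For a homogeneous polynomial `P` of degree `d`, the identity
`(1/d!)·(ad(Δ/2))^d (M_P) = ∂(P)` holds in `End_ℂ(C^∞(E,ℂ))`, i.e. both sides agree on every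
smooth function `f`. -/
theorem ad_lapHalf_pow_mulOp_eq_polyDeriv
    {E : Type*} [NormedAddCommGroup E] [InnerProductSpace ℝ E] [FiniteDimensional ℝ E]
    {n : ℕ} (b : OrthonormalBasis (Fin n) ℝ E)
    (d : ℕ) (p : MvPolynomial (Fin n) ℂ) (hp : p.IsHomogeneous d)
    (f : E → ℂ) (hf : ContDiff ℝ (⊤ : ℕ∞) f) :
    (d.factorial : ℂ)⁻¹ •
        ((fun B : (E → ℂ) → (E → ℂ) => lapHalf b ∘ B - B ∘ lapHalf b)^[d]
          (mulOp (polyFun b p)) f)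
      = polyDeriv (fun i => b i) p f := by
  let g : smoothFunctions E := ⟨f, hf⟩
  rw [← coe_ad_pow_apply b (polyMulEnd b p) (mulOp (polyFun b p)) (fun _ => rfl) d g,
    ad_lapHalfEnd_pow_polyMulEnd b hp, LinearMap.smul_apply, Submodule.coe_smul, smul_smul,
    inv_mul_cancel₀ (by exact_mod_cast d.factorial_ne_zero), one_smul, LinearMap.sum_apply]
  ext x
  simp [polyDeriv, coe_prod_map_dirDerivEnd_apply, g]
end
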